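/- Let A be a separable C*-algebra and B a stable C*-algebra. If the extension semigroups Ext_{2,a}(A,B), Ext_{2,b^cont}(A,B) and Ext_{2,c}(A,B) are all groups, then the natural surjective homomorphisms Ext_{2,a}(A,B) → Ext_{2,b^cont}(A,B) → Ext_{2,c}(A,B) (each sending the class of an extension to the class of the same extension) are isomorphisms, so these three groups coincide. Likewise, if Ext_{3,a}(A,B), Ext_{3,b^cont}(A,B) and Ext_{3,c}(A,B) are all groups, then they coincide. -/

import Mathlib

set_option synthInstance.maxHeartbeats 1000000
set_option maxHeartbeats 2000000

open Filter Topology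
open scoped MultiplierAlgebra

noncomputable section

/-- A (continuous) asymptotic homomorphism between C*-algebras, indexed by `ℝ≥0 = [0,∞)`. -/
def IsAsymptoticHom {A B : Type*} [NonUnitalCStarAlgebra A] [NonUnitalCStarAlgebra B]
    (f : NNReal → A → B) : Prop :=
  (∀ a : A, Continuous fun t => f t a) ∧
  (∀ a b : A, Tendsto (fun t => ‖f t (a * b) - f t a * f t b‖) atTop (𝓝 0)) ∧
  (∀ (μ₁ μ₂ : ℂ) (a b : A),
    Tendsto (fun t => ‖f t (μ₁ • a + μ₂ • b) - (μ₁ • f t a + μ₂ • f t b)‖) atTop (𝓝 0)) ∧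
  (∀ a : A, Tendsto (fun t => ‖f t (star a) - star (f t a)‖) atTop (𝓝 0))

/-- A discrete asymptotic homomorphism between C*-algebras, indexed by `ℕ`. -/
def IsDiscreteAsymptoticHom {A B : Type*} [NonUnitalCStarAlgebra A] [NonUnitalCStarAlgebra B]
    (f : ℕ → A → B) : Prop :=
  (∀ a b : A, Tendsto (fun n => ‖f n (a * b) - f n a * f n b‖) atTop (𝓝 0)) ∧
  (∀ (μ₁ μ₂ : ℂ) (a b : A),
    Tendsto (fun n => ‖f n (μ₁ • a + μ₂ • b) - (μ₁ • f n a + μ₂ • f n b)‖) atTop (𝓝 0)) ∧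
  (∀ a : A, Tendsto (fun n => ‖f n (star a) - star (f n a)‖) atTop (𝓝 0)) ∧
  (∀ a : A, ∃ C : ℝ, ∀ n, ‖f n a‖ ≤ C)

variable {A B : Type*} [NonUnitalCStarAlgebra A] [NonUnitalCStarAlgebra B]

/-- Membership in the canonical image of `B` inside its multiplier algebra `M(B)`;
the corona algebra is `Q(B) = M(B)/B`. -/
def InIdeal (x : 𝓜(ℂ, B)) : Prop := ∃ b : B, (b : 𝓜(ℂ, B)) = x

/-- The quotient (corona) norm `‖q(x)‖` of `x ∈ M(B)` in `Q(B) = M(B)/B`. -/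
def coronaNorm (x : 𝓜(ℂ, B)) : ℝ := sInf {r : ℝ | ∃ b : B, r = ‖x + (b : 𝓜(ℂ, B))‖}

/-- A function `T : A → M(B)` represents an extension of `A` by `B`, i.e. a ∗-homomorphism
(Busby invariant) `A → Q(B) = M(B)/B`. -/
def IsExtRep (T : A → 𝓜(ℂ, B)) : Prop :=
  (∀ a b, InIdeal (T (a * b) - T a * T b)) ∧
  (∀ a b, InIdeal (T (a + b) - (T a + T b))) ∧
  (∀ (c : ℂ) (a : A), InIdeal (T (c • a) - c • T a)) ∧
  (∀ a, InIdeal (T (star a) - star (T a)))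

/-- The extension `τ` is asymptotically split: it lifts to an asymptotic homomorphism
`A → M(B)`. -/
def AsympSplit (T : A → 𝓜(ℂ, B)) : Prop :=
  ∃ F : NNReal → A → 𝓜(ℂ, B), IsAsymptoticHom F ∧ ∀ t a, InIdeal (F t a - T a)

/-- The extension `τ` is discretely asymptotically split: it lifts to a discrete asymptotic
homomorphism `A → M(B)`. -/
def DiscAsympSplit (T : A → 𝓜(ℂ, B)) : Prop :=
  ∃ F : ℕ → A → 𝓜(ℂ, B), IsDiscreteAsymptoticHom F ∧ ∀ n a, InIdeal (F n a - T a)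

/-- (a) Unitary equivalence of extensions: `q(U)* τ₀ q(U) = τ₁` for a unitary `U ∈ M(B)`. -/
def UnitaryEquiv (T₀ T₁ : A → 𝓜(ℂ, B)) : Prop :=
  ∃ U : 𝓜(ℂ, B), star U * U = 1 ∧ U * star U = 1 ∧
    ∀ a, InIdeal (star U * T₀ a * U - T₁ a)

/-- (b^cont) Continuous approximate unitary equivalence of extensions: there is a
norm-continuous path of unitaries `U_t ∈ M(B)` with
`lim_t ‖q(U_t)* τ₀(a) q(U_t) − τ₁(a)‖ = 0` for every `a`. -/
def ContApproxUnitaryEquiv (T₀ T₁ : A → 𝓜(ℂ, B)) : Prop :=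
  ∃ U : NNReal → 𝓜(ℂ, B), Continuous U ∧
    (∀ t, star (U t) * U t = 1 ∧ U t * star (U t) = 1) ∧
    ∀ a, Tendsto (fun t => coronaNorm (star (U t) * T₀ a * U t - T₁ a)) atTop (𝓝 0)

/-- (c) Homotopy of extensions: a ∗-homomorphism `A → C([0,1], Q(B))` connecting `τ₀` and
`τ₁`; it is encoded by a representing map `Θ : A → C([0,1], M(B))` which is a ∗-homomorphism
modulo `C([0,1], B)` (this uses `C([0,1], Q(B)) ≅ C([0,1], M(B))/C([0,1], B)`). -/
def HomotopyEquivExt (T₀ T₁ : A → 𝓜(ℂ, B)) : Prop :=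
  ∃ Θ : A → C(unitInterval, 𝓜(ℂ, B)),
    (∀ a b, ∀ s, InIdeal ((Θ (a * b) - Θ a * Θ b) s)) ∧
    (∀ a b, ∀ s, InIdeal ((Θ (a + b) - (Θ a + Θ b)) s)) ∧
    (∀ (c : ℂ) (a : A), ∀ s, InIdeal ((Θ (c • a) - c • Θ a) s)) ∧
    (∀ a, ∀ s, InIdeal ((Θ (star a) - star (Θ a)) s)) ∧
    (∀ a, InIdeal (Θ a 0 - T₀ a)) ∧
    (∀ a, InIdeal (Θ a 1 - T₁ a))

/-- The sum of two extensions, via a fixed pair of isometries coming from stability of `B`. -/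
def ExtSum (S₁ S₂ : 𝓜(ℂ, B)) (T₀ T₁ : A → 𝓜(ℂ, B)) : A → 𝓜(ℂ, B) :=
  fun a => S₁ * T₀ a * star S₁ + S₂ * T₁ a * star S₂

/-- Stable equivalence of extensions, relative to a class `triv` of trivial extensions and an
equivalence `eqv`:  `τ₀ ⊕ λ₀ ≈ τ₁ ⊕ λ₁` for some trivial extensions `λ₀, λ₁`. -/
def StablyEquiv (S₁ S₂ : 𝓜(ℂ, B)) (triv : (A → 𝓜(ℂ, B)) → Prop)
    (eqv : (A → 𝓜(ℂ, B)) → (A → 𝓜(ℂ, B)) → Prop) (T₀ T₁ : A → 𝓜(ℂ, B)) : Prop :=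
  ∃ l₀ l₁ : A → 𝓜(ℂ, B), IsExtRep l₀ ∧ IsExtRep l₁ ∧ triv l₀ ∧ triv l₁ ∧
    eqv (ExtSum S₁ S₂ T₀ l₀) (ExtSum S₁ S₂ T₁ l₁)

/-- The semigroup `Ext_{triv,eqv}(A, B)` of stable equivalence classes of extensions is a
group: there is a class `ε` which is a (two-sided) identity and every class has an inverse. -/
def ExtIsGroup (S₁ S₂ : 𝓜(ℂ, B)) (triv : (A → 𝓜(ℂ, B)) → Prop)
    (eqv : (A → 𝓜(ℂ, B)) → (A → 𝓜(ℂ, B)) → Prop) : Prop :=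
  ∃ e : A → 𝓜(ℂ, B), IsExtRep e ∧
    (∀ T : A → 𝓜(ℂ, B), IsExtRep T → StablyEquiv S₁ S₂ triv eqv (ExtSum S₁ S₂ T e) T) ∧
    (∀ T : A → 𝓜(ℂ, B), IsExtRep T →
      ∃ T' : A → 𝓜(ℂ, B), IsExtRep T' ∧ StablyEquiv S₁ S₂ triv eqv (ExtSum S₁ S₂ T T') e)

section Band

variable {M : Type*} [CStarAlgebra M] [PartialOrder M] [StarOrderedRing M]

open scoped InnerProductSpace in
theorem norm_sum_mul_sq_le {n : ℕ} (a b : Fin n → M) :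
    ‖∑ k, a k * b k‖ ≤ √‖∑ k, a k * star (a k)‖ * √‖∑ k, star (b k) * b k‖ := by
  let x : WithCStarModule M (Π _ : Fin n, M) := (WithCStarModule.equiv M _).symm a
  let y : WithCStarModule M (Π _ : Fin n, M) := (WithCStarModule.equiv M _).symm (fun k => star (b k))
  have h := CStarModule.norm_inner_le (A := M) (WithCStarModule M (Π _ : Fin n, M)) (x := y) (y := x)
  rw [WithCStarModule.pi_norm, WithCStarModule.pi_norm, WithCStarModule.pi_inner] at h
  simp only [WithCStarModule.inner_def] at h
  have hx : ∀ k, x k = a k := fun k => rfl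
  have hy : ∀ k, y k = star (b k) := fun k => rfl
  simp only [hx, hy, star_star] at h
  rw [mul_comm]
  exact h

theorem norm_sum_mul_mul_le {n : ℕ} (p q y : Fin n → M) (hp : ∀ k, 0 ≤ p k) (hq : ∀ k, 0 ≤ q k)
    (hp1 : ∀ k, p k ≤ 1) (hq1 : ∀ k, q k ≤ 1)
    (hps : ∑ k, p k ≤ 1) (hqs : ∑ k, q k ≤ 1) {C : ℝ} (hC : 0 ≤ C) (hy : ∀ k, ‖y k‖ ≤ C) :
    ‖∑ k, p k * y k * q k‖ ≤ C := by
  have sq : ∀ r : M, 0 ≤ r → r ≤ 1 → r * r ≤ r := by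
    intro r h0 h1
    have := CStarAlgebra.pow_antitone h0 h1 (show 1 ≤ 2 by norm_num)
    simpa [pow_two] using this
  have nsum : ∀ (r : Fin n → M), (∀ k, 0 ≤ r k) → (∀ k, r k ≤ 1) → ∑ k, r k ≤ 1 →
      ∑ k, r k * r k ≤ 1 := by
    intro r h0 h1 hs
    exact (Finset.sum_le_sum fun k _ => sq _ (h0 k) (h1 k)).trans hs
  have h := norm_sum_mul_sq_le p (fun k => y k * q k)
  have e : ∀ k, p k * (y k * q k) = p k * y k * q k := fun k => (mul_assoc _ _ _).symm
  simp only [e, star_mul] at h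
  have h1 : ‖∑ k, p k * star (p k)‖ ≤ 1 := by
    have : ∑ k, p k * star (p k) = ∑ k, p k * p k :=
      Finset.sum_congr rfl fun k _ => by rw [(IsSelfAdjoint.of_nonneg (hp k)).star_eq]
    rw [this]
    have h0 : 0 ≤ ∑ k, p k * p k := Finset.sum_nonneg fun k _ => by
      simpa [(IsSelfAdjoint.of_nonneg (hp k)).star_eq] using mul_star_self_nonneg (p k)
    exact CStarAlgebra.norm_le_one_iff_of_nonneg _ h0 |>.mpr (nsum p hp hp1 hps)
  have h2 : ‖∑ k, star (q k) * star (y k) * (y k * q k)‖ ≤ C ^ 2 := by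
    have h0 : 0 ≤ ∑ k, star (q k) * star (y k) * (y k * q k) := Finset.sum_nonneg fun k _ => by
      simpa using star_mul_self_nonneg (y k * q k)
    have hle : ∑ k, star (q k) * star (y k) * (y k * q k) ≤ algebraMap ℝ M (C ^ 2) := by
      calc ∑ k, star (q k) * star (y k) * (y k * q k)
          ≤ ∑ k, (C ^ 2) • (q k * q k) := by
            refine Finset.sum_le_sum fun k _ => ?_
            have e1 : star (y k) * y k ≤ algebraMap ℝ M (C ^ 2) := by
              refine (CStarAlgebra.star_mul_le_algebraMap_norm_sq).trans ?_
              exact algebraMap_mono M (by gcongr; exact hy k)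
            have := star_left_conjugate_le_conjugate e1 (q k)
            rw [(IsSelfAdjoint.of_nonneg (hq k)).star_eq] at this ⊢
            calc _ = q k * (star (y k) * y k) * q k := by noncomm_ring
              _ ≤ _ := this
              _ = _ := by rw [Algebra.algebraMap_eq_smul_one]; simp
        _ = (C ^ 2) • ∑ k, q k * q k := by rw [Finset.smul_sum]
        _ ≤ (C ^ 2) • (1 : M) := smul_le_smul_of_nonneg_left (nsum q hq hq1 hqs) (by positivity)
        _ = _ := by rw [Algebra.algebraMap_eq_smul_one]
    exact (CStarAlgebra.norm_le_iff_le_algebraMap _ (by positivity) h0).mpr hle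
  calc _ ≤ _ := h
    _ ≤ √1 * √(C ^ 2) := by gcongr
    _ = C := by rw [Real.sqrt_sq hC]; simp

theorem norm_sum_sum_le_of_tridiagonal {n : ℕ} (p : ℕ → M) (hp : ∀ k, 0 ≤ p k)
    (hps : ∑ k ∈ Finset.range (n + 1), p k = 1) (y z : ℕ → ℕ → M) {C η : ℝ} (hC : 0 ≤ C)
    (hy₁ : ∀ k < n, ‖y k (k + 1)‖ ≤ C) (hy₂ : ∀ k < n, ‖y (k + 1) k‖ ≤ C)
    (hz : ∀ k < n + 1, ∀ l < n + 1,
      ‖z k l - if l = k + 1 ∨ k = l + 1 then p k * y k l * p l else 0‖ ≤ η) :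
    ‖∑ k ∈ Finset.range (n + 1), ∑ l ∈ Finset.range (n + 1), z k l‖
      ≤ 2 * C + (n + 1) ^ 2 * η := by
  have hle1 : ∀ k < n + 1, p k ≤ 1 := by
    intro k hk
    rw [← hps]
    exact Finset.single_le_sum (fun i _ => hp i) (Finset.mem_range.mpr hk)
  have hsum₁ : ∑ k : Fin n, p k ≤ 1 := by
    rw [Fin.sum_univ_eq_sum_range, ← hps, Finset.sum_range_succ]
    exact le_add_of_nonneg_right (hp n)
  have hsum₂ : ∑ k : Fin n, p (k + 1) ≤ 1 := by
    rw [Fin.sum_univ_eq_sum_range (fun k => p (k + 1)), ← hps, Finset.sum_range_succ']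
    exact le_add_of_nonneg_right (hp 0)
  have hA : ‖∑ k ∈ Finset.range n, p k * y k (k + 1) * p (k + 1)‖ ≤ C := by
    rw [← Fin.sum_univ_eq_sum_range (fun k => p k * y k (k + 1) * p (k + 1))]
    exact norm_sum_mul_mul_le (fun k : Fin n => p k) (fun k : Fin n => p (k + 1))
      (fun k : Fin n => y k (k + 1)) (fun k => hp _) (fun k => hp _)
      (fun k => hle1 _ (by omega)) (fun k => hle1 _ (by omega)) hsum₁ hsum₂ hC
      (fun k => hy₁ k k.2)
  have hB : ‖∑ k ∈ Finset.range n, p (k + 1) * y (k + 1) k * p k‖ ≤ C := by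
    rw [← Fin.sum_univ_eq_sum_range (fun k => p (k + 1) * y (k + 1) k * p k)]
    exact norm_sum_mul_mul_le (fun k : Fin n => p (k + 1)) (fun k : Fin n => p k)
      (fun k : Fin n => y (k + 1) k) (fun k => hp _) (fun k => hp _)
      (fun k => hle1 _ (by omega)) (fun k => hle1 _ (by omega)) hsum₂ hsum₁ hC
      (fun k => hy₂ k k.2)
  have split : ∑ k ∈ Finset.range (n + 1), ∑ l ∈ Finset.range (n + 1),
      (if l = k + 1 ∨ k = l + 1 then p k * y k l * p l else 0)
      = ∑ k ∈ Finset.range n, p k * y k (k + 1) * p (k + 1)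
        + ∑ k ∈ Finset.range n, p (k + 1) * y (k + 1) k * p k := by
    have h1 : ∀ k l, (if l = k + 1 ∨ k = l + 1 then p k * y k l * p l else 0)
        = (if l = k + 1 then p k * y k l * p l else 0)
          + (if k = l + 1 then p k * y k l * p l else 0) := by
      intro k l
      by_cases h1 : l = k + 1
      · have : ¬ k = l + 1 := by omega
        rw [if_pos (Or.inl h1), if_pos h1, if_neg this, add_zero]
      · simp [h1]
    simp only [h1, Finset.sum_add_distrib]
    congr 1
    · rw [Finset.sum_range_succ]
      simp only [Finset.sum_ite_eq', Finset.mem_range]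
      simp only [lt_self_iff_false, if_false, add_zero]
      exact Finset.sum_congr rfl fun k hk => by
        have := Finset.mem_range.mp hk
        simp [this]
    · rw [Finset.sum_comm, Finset.sum_range_succ]
      simp only [Finset.sum_ite_eq', Finset.mem_range]
      simp only [lt_self_iff_false, if_false, add_zero]
      exact Finset.sum_congr rfl fun k hk => by
        have := Finset.mem_range.mp hk
        simp [this]
  have hE : ‖∑ k ∈ Finset.range (n + 1), ∑ l ∈ Finset.range (n + 1), (z k l -
      if l = k + 1 ∨ k = l + 1 then p k * y k l * p l else 0)‖ ≤ (n + 1) ^ 2 * η := by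
    calc _ ≤ ∑ k ∈ Finset.range (n + 1), ∑ l ∈ Finset.range (n + 1), η := by
          refine norm_sum_le_of_le _ fun k hk => norm_sum_le_of_le _ fun l hl => ?_
          exact hz k (Finset.mem_range.mp hk) l (Finset.mem_range.mp hl)
      _ = _ := by simp; ring
  have : ∑ k ∈ Finset.range (n + 1), ∑ l ∈ Finset.range (n + 1), z k l
      = (∑ k ∈ Finset.range (n + 1), ∑ l ∈ Finset.range (n + 1), (z k l -
      if l = k + 1 ∨ k = l + 1 then p k * y k l * p l else 0))
      + (∑ k ∈ Finset.range n, p k * y k (k + 1) * p (k + 1)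
        + ∑ k ∈ Finset.range n, p (k + 1) * y (k + 1) k * p k) := by
    rw [← split]
    simp only [Finset.sum_sub_distrib, sub_add_cancel]
  rw [this]
  calc _ ≤ _ + (_ + _) := (norm_add_le _ _).trans (by gcongr; exact norm_add_le _ _)
    _ ≤ (n + 1) ^ 2 * η + (C + C) := by gcongr
    _ = _ := by ring

end Band

section Chain

/-- The `k`-th increment of the chain `0, w 0, …, w (n - 1), 1`. -/
def chainIncr {M : Type*} [Ring M] (w : ℕ → M) (n k : ℕ) : M :=
  (if k < n then w k else 1) - (if k = 0 then 0 else w (k - 1))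

theorem sum_chainIncr_mul {M : Type*} [Ring M] (w x : ℕ → M) (n : ℕ) :
    ∑ k ∈ Finset.range (n + 1), chainIncr w n k * x k
      = x 0 + ∑ i ∈ Finset.range n, (1 - w i) * (x (i + 1) - x i) := by
  induction n with
  | zero => simp [chainIncr]
  | succ n ih =>
    rw [Finset.sum_range_succ _ n, ← add_assoc, ← ih, Finset.sum_range_succ _ (n + 1),
      Finset.sum_range_succ _ n, Finset.sum_range_succ _ n]
    have h : ∀ k ∈ Finset.range n, chainIncr w (n + 1) k * x k = chainIncr w n k * x k := by
      intro k hk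
      have h1 := Finset.mem_range.mp hk
      have h2 : k < n + 1 := by omega
      simp [chainIncr, h1, h2]
    rw [Finset.sum_congr rfl h]
    have e1 : chainIncr w (n + 1) (n + 1) = 1 - w n := by simp [chainIncr]
    have e2 : chainIncr w (n + 1) n = w n - (if n = 0 then 0 else w (n - 1)) := by
      simp [chainIncr]
    have e3 : chainIncr w n n = 1 - (if n = 0 then 0 else w (n - 1)) := by simp [chainIncr]
    rw [e1, e2, e3]
    noncomm_ring

theorem sum_chainIncr {M : Type*} [Ring M] (w : ℕ → M) (n : ℕ) :
    ∑ k ∈ Finset.range (n + 1), chainIncr w n k = 1 := by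
  simpa using sum_chainIncr_mul w 1 n

variable {M : Type*} [CStarAlgebra M] [PartialOrder M] [StarOrderedRing M]

theorem chainIncr_nonneg {w : ℕ → M} (hw : ∀ i j, i < j → w i ≤ w j) (h0 : ∀ i, 0 ≤ w i)
    (h1 : ∀ i, w i ≤ 1) (n k : ℕ) : 0 ≤ chainIncr w n k := by
  unfold chainIncr
  rw [sub_nonneg]
  rcases Nat.eq_zero_or_pos k with rfl | hk
  · split_ifs <;> simp_all
  · rw [if_neg hk.ne']
    split_ifs
    · exact hw _ _ (by omega)
    · exact h1 _

theorem chainIncr_eq_of_lt {M : Type*} [Ring M] (w : ℕ → M) {n k : ℕ} (h : k < n) :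
    chainIncr w n k = w k - if k = 0 then 0 else w (k - 1) := by
  simp [chainIncr, h]

theorem chainIncr_eq_of_pos {M : Type*} [Ring M] (w : ℕ → M) {n l : ℕ} (h : 0 < l) :
    chainIncr w n l = (1 - w (l - 1)) - if l < n then 1 - w l else 0 := by
  unfold chainIncr
  rw [if_neg h.ne']
  split_ifs <;> noncomm_ring

theorem norm_sub_mul_sub_le {M : Type*} [NormedRing M] {a b c d m : M} {η : ℝ}
    (h1 : ‖a * m * c‖ ≤ η) (h2 : ‖a * m * d‖ ≤ η) (h3 : ‖b * m * c‖ ≤ η) (h4 : ‖b * m * d‖ ≤ η) :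
    ‖(a - b) * m * (c - d)‖ ≤ 4 * η := by
  have : (a - b) * m * (c - d) = (a * m * c - a * m * d) - (b * m * c - b * m * d) := by
    noncomm_ring
  rw [this]
  calc _ ≤ (‖a * m * c‖ + ‖a * m * d‖) + (‖b * m * c‖ + ‖b * m * d‖) :=
        (norm_sub_le _ _).trans (add_le_add (norm_sub_le _ _) (norm_sub_le _ _))
    _ ≤ (η + η) + (η + η) := by gcongr
    _ = _ := by ring

theorem norm_chainIncr_mul_mul_le {M : Type*} [NormedRing M] {w : ℕ → M} {n k l : ℕ} {m : M}
    {η : ℝ} (hkl : k + 2 ≤ l) (hl : l ≤ n)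
    (h : ∀ i j, i < j → l ≤ j + 1 → ‖w i * m * (1 - w j)‖ ≤ η) :
    ‖chainIncr w n k * m * chainIncr w n l‖ ≤ 4 * η := by
  have hη : 0 ≤ η := (norm_nonneg _).trans (h k (l - 1) (by omega) (by omega))
  rw [chainIncr_eq_of_lt w (show k < n by omega), chainIncr_eq_of_pos w (show 0 < l by omega)]
  apply norm_sub_mul_sub_le
  · exact h _ _ (by omega) (by omega)
  · split_ifs
    · exact h _ _ (by omega) (by omega)
    · simpa
  · split_ifs
    · simpa
    · exact h _ _ (by omega) (by omega)
  · split_ifs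
    · simpa
    · simpa
    · exact h _ _ (by omega) (by omega)
    · simpa

theorem norm_chainIncr_mul_mul_le' {M : Type*} [NormedRing M] {w : ℕ → M} {n k l : ℕ} {m : M}
    {η : ℝ} (hkl : k + 2 ≤ l) (hl : l ≤ n)
    (h : ∀ i j, i < j → l ≤ j + 1 → ‖(1 - w j) * m * w i‖ ≤ η) :
    ‖chainIncr w n l * m * chainIncr w n k‖ ≤ 4 * η := by
  have hη : 0 ≤ η := (norm_nonneg _).trans (h k (l - 1) (by omega) (by omega))
  rw [chainIncr_eq_of_lt w (show k < n by omega), chainIncr_eq_of_pos w (show 0 < l by omega)]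
  apply norm_sub_mul_sub_le
  · exact h _ _ (by omega) (by omega)
  · split_ifs
    · simpa
    · exact h _ _ (by omega) (by omega)
  · split_ifs
    · exact h _ _ (by omega) (by omega)
    · simpa
  · split_ifs
    · simpa
    · exact h _ _ (by omega) (by omega)
    · simpa
    · simpa

end Chain

section ApproxIdeal

variable {M : Type*} [CStarAlgebra M] [PartialOrder M] [StarOrderedRing M]

/-- A self-adjoint two-sided ideal of a C⋆-algebra with an increasing approximate unit. -/
structure ApproxIdeal (J : Submodule ℂ M) : Prop where
  mul_left : ∀ (m : M) {x : M}, x ∈ J → m * x ∈ J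
  mul_right : ∀ (m : M) {x : M}, x ∈ J → x * m ∈ J
  star_mem : ∀ {x : M}, x ∈ J → star x ∈ J
  exists_approx : ∀ X V : Finset M, (∀ x ∈ X, x ∈ J) → (∀ v ∈ V, v ∈ J ∧ 0 ≤ v ∧ ‖v‖ < 1) →
    ∀ η > 0, ∃ w ∈ J, 0 ≤ w ∧ ‖w‖ < 1 ∧ (∀ v ∈ V, v ≤ w) ∧ ∀ x ∈ X, ‖(1 - w) * x‖ ≤ η

theorem le_one_of_norm_lt {w : M} (h0 : 0 ≤ w) (h : ‖w‖ < 1) : w ≤ 1 :=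
  (CStarAlgebra.norm_le_one_iff_of_nonneg w h0).mp h.le

theorem norm_one_sub_le {w : M} (h0 : 0 ≤ w) (h : w ≤ 1) : ‖1 - w‖ ≤ 1 :=
  (CStarAlgebra.norm_le_one_iff_of_nonneg _ (sub_nonneg.mpr h)).mpr (sub_le_self 1 h0)

variable {J : Submodule ℂ M}

theorem ApproxIdeal.exists_approx_compact (hJ : ApproxIdeal J) {K : Set M} (hK : IsCompact K)
    (hKJ : ∀ x ∈ K, x ∈ J) (V : Finset M) (hV : ∀ v ∈ V, v ∈ J ∧ 0 ≤ v ∧ ‖v‖ < 1)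
    {η : ℝ} (hη : 0 < η) :
    ∃ w ∈ J, 0 ≤ w ∧ ‖w‖ < 1 ∧ (∀ v ∈ V, v ≤ w) ∧
      ∀ x ∈ K, ‖(1 - w) * x‖ ≤ η ∧ ‖x * (1 - w)‖ ≤ η := by
  classical
  obtain ⟨t, htK, htf, hcov⟩ := hK.finite_cover_balls (half_pos hη)
  let X : Finset M := htf.toFinset ∪ htf.toFinset.image star
  have hX : ∀ x ∈ X, x ∈ J := by
    intro x hx
    simp only [X, Finset.mem_union, Finset.mem_image, Set.Finite.mem_toFinset] at hx
    rcases hx with hx | ⟨y, hy, rfl⟩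
    · exact hKJ _ (htK hx)
    · exact hJ.star_mem (hKJ _ (htK hy))
  obtain ⟨w, hwJ, hw0, hw1, hwV, hwX⟩ := hJ.exists_approx X V hX hV (η / 2) (half_pos hη)
  refine ⟨w, hwJ, hw0, hw1, hwV, fun x hx => ?_⟩
  obtain ⟨y, hy, hxy⟩ : ∃ y ∈ t, x ∈ Metric.ball y (η / 2) := by simpa using hcov hx
  rw [mem_ball_iff_norm] at hxy
  have h1 : ‖1 - w‖ ≤ 1 := norm_one_sub_le hw0 (le_one_of_norm_lt hw0 hw1)
  have hy1 : ‖(1 - w) * y‖ ≤ η / 2 := hwX y (by simp [X, hy])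
  have hy2 : ‖y * (1 - w)‖ ≤ η / 2 := by
    have := hwX (star y) (by simp [X, hy])
    rw [← norm_star] at this
    simpa [(IsSelfAdjoint.of_nonneg hw0).star_eq] using this
  constructor
  · have : (1 - w) * x = (1 - w) * (x - y) + (1 - w) * y := by noncomm_ring
    rw [this]
    calc _ ≤ ‖1 - w‖ * ‖x - y‖ + ‖(1 - w) * y‖ :=
          (norm_add_le _ _).trans (by gcongr; exact norm_mul_le _ _)
      _ ≤ 1 * (η / 2) + η / 2 := by gcongr
      _ = η := by ring
  · have : x * (1 - w) = (x - y) * (1 - w) + y * (1 - w) := by noncomm_ring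
    rw [this]
    calc _ ≤ ‖x - y‖ * ‖1 - w‖ + ‖y * (1 - w)‖ :=
          (norm_add_le _ _).trans (by gcongr; exact norm_mul_le _ _)
      _ ≤ (η / 2) * 1 + η / 2 := by gcongr
      _ = η := by ring

end ApproxIdeal

section QuasiCentral

variable {M : Type*} [CStarAlgebra M] [PartialOrder M] [StarOrderedRing M] {J : Submodule ℂ M}

theorem sum_mul_sub_mul_sum {M : Type*} [CStarAlgebra M] {p : ℕ → M} {N : ℕ} (hp : ∑ k ∈ Finset.range N, p k = 1)
    (c : ℕ → ℝ) (m : M) :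
    (∑ k ∈ Finset.range N, p k * (c k • (1 : M))) * m - m * ∑ k ∈ Finset.range N, p k * (c k • (1 : M))
      = ∑ k ∈ Finset.range N, ∑ l ∈ Finset.range N, p k * ((c k - c l) • m) * p l := by
  have h1 : (∑ k ∈ Finset.range N, p k * (c k • (1 : M))) * m
      = (∑ k ∈ Finset.range N, p k * (c k • (1 : M))) * m * ∑ l ∈ Finset.range N, p l := by
    rw [hp, mul_one]
  have h2 : m * ∑ k ∈ Finset.range N, p k * (c k • (1 : M))
      = (∑ k ∈ Finset.range N, p k) * m * ∑ l ∈ Finset.range N, p l * (c l • (1 : M)) := by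
    rw [hp, one_mul]
  have h3 : ∀ k l, p k * ((c k - c l) • m) * p l
      = p k * (c k • (1 : M)) * m * p l - p k * m * (p l * (c l • (1 : M))) := by
    intro k l
    simp only [mul_smul_comm, smul_mul_assoc, mul_one, sub_smul, mul_sub, sub_mul]
  simp only [h3, Finset.sum_sub_distrib, ← Finset.mul_sum, ← Finset.sum_mul]
  rw [← h1, ← h2]

theorem ApproxIdeal.exists_quasicentral (hJ : ApproxIdeal J) {K₁ K₂ : Set M}
    (hK₁ : IsCompact K₁) (hK₂ : IsCompact K₂) (hK₂J : ∀ x ∈ K₂, x ∈ J)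
    (V : Finset M) (hV : ∀ v ∈ V, v ∈ J ∧ 0 ≤ v ∧ ‖v‖ < 1) {ε : ℝ} (hε : 0 < ε) :
    ∃ u ∈ J, 0 ≤ u ∧ ‖u‖ < 1 ∧ (∀ v ∈ V, v ≤ u) ∧ (∀ m ∈ K₁, ‖u * m - m * u‖ ≤ ε) ∧
      ∀ x ∈ K₂, ‖(1 - u) * x‖ ≤ ε ∧ ‖x * (1 - u)‖ ≤ ε := by
  classical
  obtain ⟨R, hR0, hR⟩ : ∃ R : ℝ, 0 < R ∧ ∀ m ∈ K₁, ‖m‖ ≤ R := by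
    obtain ⟨R, hR⟩ := hK₁.isBounded.exists_norm_le
    exact ⟨max R 1, by positivity, fun m hm => (hR m hm).trans (le_max_left _ _)⟩
  obtain ⟨n, hn0, hn⟩ : ∃ n : ℕ, 0 < n ∧ 2 * (R / n) ≤ ε / 2 := by
    obtain ⟨n, hn⟩ := exists_nat_gt (4 * R / ε)
    have hn0 : (0 : ℝ) < n := lt_of_le_of_lt (by positivity) hn
    refine ⟨n, by exact_mod_cast hn0, ?_⟩
    rw [div_lt_iff₀ hε] at hn
    rw [← mul_div_assoc, div_le_iff₀ hn0]
    linarith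
  set η : ℝ := ε / 2 / (n + 1) ^ 2 / 4 with hηdef
  have hη : 0 < η := by positivity
  obtain ⟨w, hwP, hwr⟩ := exists_seq_of_forall_finset_exists
    (fun y : M => y ∈ J ∧ 0 ≤ y ∧ ‖y‖ < 1 ∧ (∀ v ∈ V, v ≤ y) ∧
      ∀ x ∈ K₂, ‖(1 - y) * x‖ ≤ ε ∧ ‖x * (1 - y)‖ ≤ ε)
    (fun x y => x ≤ y ∧ ∀ m ∈ K₁, ‖(1 - y) * (m * x)‖ ≤ η ∧ ‖x * m * (1 - y)‖ ≤ η) (by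
      intro s hs
      have hKc : IsCompact (K₂ ∪ ⋃ x ∈ s, (((fun m => m * x) '' K₁) ∪ ((fun m => x * m) '' K₁))) := by
        refine hK₂.union (s.isCompact_biUnion fun x _ => (hK₁.image ?_).union (hK₁.image ?_))
        · exact continuous_id.mul continuous_const
        · exact continuous_const.mul continuous_id
      obtain ⟨y, hyJ, hy0, hy1, hyV, hyK⟩ := hJ.exists_approx_compact hKc (by
        rintro x (hx | hx)
        · exact hK₂J x hx
        · simp only [Set.mem_iUnion, Set.mem_union, Set.mem_image] at hx
          obtain ⟨z, hz, ⟨m, -, rfl⟩ | ⟨m, -, rfl⟩⟩ := hx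
          · exact hJ.mul_left _ (hs z hz).1
          · exact hJ.mul_right _ (hs z hz).1) (V ∪ s) (by
        intro v hv
        rcases Finset.mem_union.mp hv with hv | hv
        · exact hV v hv
        · exact ⟨(hs v hv).1, (hs v hv).2.1, (hs v hv).2.2.1⟩) (lt_min hε hη)
      refine ⟨y, ⟨hyJ, hy0, hy1, fun v hv => hyV v (Finset.mem_union_left _ hv), fun x hx => ?_⟩,
        fun x hx => ⟨hyV x (Finset.mem_union_right _ hx), fun m hm => ⟨?_, ?_⟩⟩⟩
      · have := hyK x (Or.inl hx)
        exact ⟨this.1.trans (min_le_left _ _), this.2.trans (min_le_left _ _)⟩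
      · refine (hyK (m * x) (Or.inr ?_)).1.trans (min_le_right _ _)
        simp only [Set.mem_iUnion]
        exact ⟨x, hx, Or.inl ⟨m, hm, rfl⟩⟩
      · refine (hyK (x * m) (Or.inr ?_)).2.trans (min_le_right _ _)
        simp only [Set.mem_iUnion]
        exact ⟨x, hx, Or.inr ⟨m, hm, rfl⟩⟩)
  have hnR : (0 : ℝ) < n := by exact_mod_cast hn0
  set u : M := (n : ℝ)⁻¹ • ∑ i ∈ Finset.range n, w i with hu
  have avg : ∀ x : M, x = (n : ℝ)⁻¹ • ∑ i ∈ Finset.range n, x := by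
    intro x
    rw [Finset.sum_const, Finset.card_range, ← Nat.cast_smul_eq_nsmul ℝ, smul_smul,
      inv_mul_cancel₀ hnR.ne', one_smul]
  have avgn : ∀ (x : ℕ → M) (C : ℝ), (∀ i, ‖x i‖ ≤ C) →
      ‖(n : ℝ)⁻¹ • ∑ i ∈ Finset.range n, x i‖ ≤ C := by
    intro x C hx
    rw [norm_smul, norm_inv, Real.norm_natCast]
    calc _ ≤ (n : ℝ)⁻¹ * ∑ i ∈ Finset.range n, C := by
          gcongr
          exact norm_sum_le_of_le _ fun i _ => hx i
      _ = C := by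
        rw [Finset.sum_const, Finset.card_range, nsmul_eq_mul, ← mul_assoc,
          inv_mul_cancel₀ hnR.ne', one_mul]
  refine ⟨u, ?_, ?_, ?_, ?_, ?_, ?_⟩
  · exact J.smul_of_tower_mem _ (J.sum_mem fun i _ => (hwP i).1)
  · exact smul_nonneg (by positivity) (Finset.sum_nonneg fun i _ => (hwP i).2.1)
  · rw [hu, norm_smul, norm_inv, Real.norm_natCast]
    calc _ ≤ (n : ℝ)⁻¹ * ∑ i ∈ Finset.range n, ‖w i‖ := by
          gcongr
          exact norm_sum_le _ _
      _ < (n : ℝ)⁻¹ * ∑ i ∈ Finset.range n, 1 := by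
        refine mul_lt_mul_of_pos_left ?_ (by positivity)
        exact Finset.sum_lt_sum_of_nonempty (by simpa using hn0.ne') fun i _ => (hwP i).2.2.1
      _ = 1 := by simp [hnR.ne']
  · intro v hv
    rw [avg v]
    exact smul_le_smul_of_nonneg_left (Finset.sum_le_sum fun i _ => (hwP i).2.2.2.1 v hv)
      (by positivity)
  · intro m hm
    have hps := sum_chainIncr w n
    have hp := chainIncr_nonneg (fun i j h => (hwr i j h).1) (fun i => (hwP i).2.1)
      (fun i => le_one_of_norm_lt (hwP i).2.1 (hwP i).2.2.1) n
    set c : ℕ → ℝ := fun k => ((n : ℝ) - k) / n with hc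
    have hcd : ∀ k, c (k + 1) - c k = - (n : ℝ)⁻¹ := by
      intro k
      simp only [hc]
      push_cast
      field_simp
      ring
    have huc : u = ∑ k ∈ Finset.range (n + 1), chainIncr w n k * (c k • (1 : M)) := by
      rw [sum_chainIncr_mul w (fun k => c k • (1 : M))]
      simp only [← sub_smul, hcd]
      have hc0 : c 0 = 1 := by simp [hc, hnR.ne']
      simp only [mul_smul_comm, mul_one, ← Finset.smul_sum]
      rw [Finset.sum_sub_distrib, smul_sub, neg_smul, ← avg 1, hc0, neg_smul, hu]
      simp
    rw [huc, sum_mul_sub_mul_sum hps]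
    have hc1 : ∀ k ≤ n, ∀ l ≤ n, |c k - c l| ≤ 1 := by
      intro k hk l hl
      have hk' : (k : ℝ) ≤ n := by exact_mod_cast hk
      have hl' : (l : ℝ) ≤ n := by exact_mod_cast hl
      have hk0 : (0 : ℝ) ≤ k := by positivity
      have hl0 : (0 : ℝ) ≤ l := by positivity
      simp only [hc]
      rw [← sub_div, abs_div, abs_of_pos hnR, div_le_one hnR, abs_le]
      constructor <;> linarith
    have hmR := hR m hm
    refine (norm_sum_sum_le_of_tridiagonal (C := R / n) (η := 4 * η) (chainIncr w n) hp hps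
      (fun k l => (c k - c l) • m) _ (by positivity) ?_ ?_ ?_).trans ?_
    · intro k _
      rw [norm_smul, ← neg_sub, hcd, neg_neg, norm_inv, Real.norm_natCast, inv_mul_eq_div]
      gcongr
    · intro k _
      rw [norm_smul, hcd, norm_neg, norm_inv, Real.norm_natCast, inv_mul_eq_div]
      gcongr
    · intro k hk l hl
      split_ifs with hkl
      · simp; positivity
      · rw [sub_zero, mul_smul_comm, smul_mul_assoc, norm_smul, Real.norm_eq_abs]
        have h4 : ‖chainIncr w n k * m * chainIncr w n l‖ ≤ 4 * η ∨ k = l := by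
          rcases lt_trichotomy k l with h | h | h
          · left
            exact norm_chainIncr_mul_mul_le (by omega) (by omega)
              fun i j hij _ => ((hwr i j hij).2 m hm).2
          · exact Or.inr h
          · left
            refine norm_chainIncr_mul_mul_le' (by omega) (by omega)
              fun i j hij _ => ?_
            rw [mul_assoc]
            exact ((hwr i j hij).2 m hm).1
        rcases h4 with h4 | rfl
        · calc _ ≤ 1 * (4 * η) := by
                gcongr
                exact hc1 k (by omega) l (by omega)
            _ = _ := one_mul _
        · simp; positivity
    · have : ((n : ℝ) + 1) ^ 2 * (4 * η) = ε / 2 := by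
        rw [hηdef]; field_simp
      rw [this]
      linarith
  · intro x hx
    constructor
    · have : (1 - u) * x = (n : ℝ)⁻¹ • ∑ i ∈ Finset.range n, (1 - w i) * x := by
        rw [← Finset.sum_mul, Finset.sum_sub_distrib, ← smul_mul_assoc, smul_sub, ← avg 1]
      rw [this]
      exact avgn _ _ fun i => ((hwP i).2.2.2.2 x hx).1
    · have : x * (1 - u) = (n : ℝ)⁻¹ • ∑ i ∈ Finset.range n, x * (1 - w i) := by
        rw [← Finset.mul_sum, Finset.sum_sub_distrib, ← mul_smul_comm, smul_sub, ← avg 1]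
      rw [this]
      exact avgn _ _ fun i => ((hwP i).2.2.2.2 x hx).2

end QuasiCentral

section QuasiCentralSeq

variable {M : Type*} [CStarAlgebra M] [PartialOrder M] [StarOrderedRing M] {J : Submodule ℂ M}

theorem ApproxIdeal.exists_quasicentral_seq (hJ : ApproxIdeal J) {K₁ K₂ : ℕ → Set M}
    (hK₁ : ∀ i, IsCompact (K₁ i)) (hK₂ : ∀ i, IsCompact (K₂ i)) (hK₂J : ∀ i, ∀ x ∈ K₂ i, x ∈ J)
    (hm₁ : Monotone K₁) (hm₂ : Monotone K₂) :
    ∃ u : ℕ → M, (∀ i, u i ∈ J ∧ 0 ≤ u i ∧ ‖u i‖ < 1) ∧ (∀ i j, i < j → u i ≤ u j) ∧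
      (∀ i j, i < j → ‖(1 - u j) * u i‖ ≤ (1 / 4 : ℝ) ^ j) ∧
      (∀ i, ∀ m ∈ K₁ i, ‖u i * m - m * u i‖ ≤ (1 / 4 : ℝ) ^ i) ∧
      ∀ i, ∀ x ∈ K₂ i, ‖(1 - u i) * x‖ ≤ (1 / 4 : ℝ) ^ i ∧ ‖x * (1 - u i)‖ ≤ (1 / 4 : ℝ) ^ i := by
  classical
  obtain ⟨f, hfP, hfr⟩ := exists_seq_of_forall_finset_exists
    (fun y : ℕ × M => (y.2 ∈ J ∧ 0 ≤ y.2 ∧ ‖y.2‖ < 1) ∧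
      (∀ m ∈ K₁ y.1, ‖y.2 * m - m * y.2‖ ≤ (1 / 4 : ℝ) ^ y.1) ∧
      ∀ x ∈ K₂ y.1, ‖(1 - y.2) * x‖ ≤ (1 / 4 : ℝ) ^ y.1 ∧ ‖x * (1 - y.2)‖ ≤ (1 / 4 : ℝ) ^ y.1)
    (fun x y => x.1 < y.1 ∧ x.2 ≤ y.2 ∧ ‖(1 - y.2) * x.2‖ ≤ (1 / 4 : ℝ) ^ y.1) (by
      intro s hs
      set i : ℕ := s.sup Prod.fst + 1 with hi
      have hfin : IsCompact ((s.image Prod.snd : Finset M) : Set M) :=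
        (Finset.finite_toSet _).isCompact
      obtain ⟨u, huJ, hu0, hu1, huV, huK₁, huK₂⟩ := hJ.exists_quasicentral (hK₁ i)
        ((hK₂ i).union hfin) (by
          rintro x (hx | hx)
          · exact hK₂J i x hx
          · simp only [Finset.coe_image, Set.mem_image, Finset.mem_coe] at hx
            obtain ⟨z, hz, rfl⟩ := hx
            exact (hs z hz).1.1) (s.image Prod.snd) (by
          intro v hv
          obtain ⟨z, hz, rfl⟩ := Finset.mem_image.mp hv
          exact (hs z hz).1) (ε := (1 / 4 : ℝ) ^ i) (by positivity)
      refine ⟨(i, u), ⟨⟨huJ, hu0, hu1⟩, huK₁, fun x hx => huK₂ x (Or.inl hx)⟩, fun x hx => ?_⟩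
      have hx2 : x.2 ∈ s.image Prod.snd := Finset.mem_image_of_mem _ hx
      exact ⟨Nat.lt_succ_of_le (Finset.le_sup (f := Prod.fst) hx), huV _ hx2,
        (huK₂ _ (Or.inr hx2)).1⟩)
  have hmono : StrictMono fun n => (f n).1 := fun m n h => (hfr m n h).1
  have hge : ∀ n, n ≤ (f n).1 := fun n => hmono.id_le n
  have hpow : ∀ n, (1 / 4 : ℝ) ^ (f n).1 ≤ (1 / 4 : ℝ) ^ n := fun n =>
    pow_le_pow_of_le_one (by norm_num) (by norm_num) (hge n)
  refine ⟨fun n => (f n).2, fun i => (hfP i).1, fun i j h => (hfr i j h).2.1,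
    fun i j h => ((hfr i j h).2.2).trans (hpow j),
    fun i m hm => ((hfP i).2.1 m (hm₁ (hge i) hm)).trans (hpow i),
    fun i x hx => ⟨((hfP i).2.2 x (hm₂ (hge i) hx)).1.trans (hpow i),
      ((hfP i).2.2 x (hm₂ (hge i) hx)).2.trans (hpow i)⟩⟩

end QuasiCentralSeq

section Eval

/-- The nodes of a partition of `[0, 1]` that vanish for `i ≤ r` and reach `1` at `i = 2 * r + 1`. -/
def evalNode (r : ℝ) (i : ℕ) : unitInterval :=
  Set.projIcc 0 1 zero_le_one ((i - r) / (r + 1))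

theorem evalNode_eq_zero {r : ℝ} (hr : 0 ≤ r) {i : ℕ} (h : (i : ℝ) ≤ r) : evalNode r i = 0 :=
  Set.projIcc_of_le_left _ (div_nonpos_of_nonpos_of_nonneg (by linarith) (by linarith))

theorem evalNode_eq_one {r : ℝ} (hr : 0 ≤ r) {i : ℕ} (h : 2 * r + 1 ≤ i) : evalNode r i = 1 :=
  Set.projIcc_of_right_le _ ((one_le_div (by linarith)).mpr (by linarith))

theorem dist_evalNode_succ_le {r : ℝ} (hr : 0 ≤ r) (i : ℕ) :
    dist (evalNode r (i + 1)) (evalNode r i) ≤ (r + 1)⁻¹ := by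
  have h := Set.abs_projIcc_sub_projIcc (c := (((i + 1 : ℕ) : ℝ) - r) / (r + 1))
    (d := ((i : ℝ) - r) / (r + 1)) (zero_le_one (α := ℝ))
  rw [Subtype.dist_eq, Real.dist_eq]
  refine h.trans ?_
  rw [← sub_div]
  push_cast
  have : ((i : ℝ) + 1 - r - (i - r)) / (r + 1) = (r + 1)⁻¹ := by
    rw [← one_div]; congr 1; ring
  rw [this, abs_of_pos (by positivity)]

variable {M : Type*} [CStarAlgebra M]

/-- Evaluation of a path along the nodes `evalNode r`, smeared out by the sequence `u`. -/
def chainEval (u : ℕ → M) (r : ℝ) (θ : C(unitInterval, M)) : M :=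
  θ 0 + ∑ i ∈ Finset.range (2 * ⌊r⌋₊ + 3), (1 - u i) * (θ (evalNode r (i + 1)) - θ (evalNode r i))

theorem lt_of_floor_index {r : ℝ} : 2 * r + 1 ≤ ((2 * ⌊r⌋₊ + 3 : ℕ) : ℝ) := by
  have := Nat.lt_floor_add_one r
  push_cast
  linarith

theorem chainEval_eq (u : ℕ → M) {r : ℝ} (hr : 0 ≤ r) (θ : C(unitInterval, M)) {n : ℕ}
    (hn : 2 * ⌊r⌋₊ + 3 ≤ n) :
    chainEval u r θ
      = θ 0 + ∑ i ∈ Finset.range n, (1 - u i) * (θ (evalNode r (i + 1)) - θ (evalNode r i)) := by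
  unfold chainEval
  congr 1
  refine Finset.sum_subset (Finset.range_subset_range.mpr hn) fun i _ hi => ?_
  have hi' : 2 * ⌊r⌋₊ + 3 ≤ i := by simpa using hi
  have h1 : 2 * r + 1 ≤ (i : ℝ) := lt_of_floor_index.trans (by exact_mod_cast hi')
  rw [evalNode_eq_one hr h1, evalNode_eq_one hr (by push_cast; linarith), sub_self, mul_zero]

theorem chainEval_eq_sum (u : ℕ → M) {r : ℝ} (hr : 0 ≤ r) (θ : C(unitInterval, M)) :
    chainEval u r θ = ∑ k ∈ Finset.range (2 * ⌊r⌋₊ + 3 + 1),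
      chainIncr u (2 * ⌊r⌋₊ + 3) k * θ (evalNode r k) := by
  rw [sum_chainIncr_mul u fun k => θ (evalNode r k), evalNode_eq_zero hr (by simpa using hr)]
  rfl

theorem chainEval_add (u : ℕ → M) (r : ℝ) (θ θ' : C(unitInterval, M)) :
    chainEval u r (θ + θ') = chainEval u r θ + chainEval u r θ' := by
  simp only [chainEval, ContinuousMap.add_apply, add_sub_add_comm, mul_add, Finset.sum_add_distrib]
  abel

theorem chainEval_smul (u : ℕ → M) (r : ℝ) (c : ℂ) (θ : C(unitInterval, M)) :
    chainEval u r (c • θ) = c • chainEval u r θ := by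
  simp only [chainEval, ContinuousMap.smul_apply, ← smul_sub, mul_smul_comm, smul_add,
    Finset.smul_sum]

theorem chainEval_sub (u : ℕ → M) (r : ℝ) (θ θ' : C(unitInterval, M)) :
    chainEval u r (θ - θ') = chainEval u r θ - chainEval u r θ' := by
  rw [sub_eq_add_neg, ← neg_one_smul ℂ θ', chainEval_add, chainEval_smul, neg_one_smul,
    ← sub_eq_add_neg]

theorem continuous_chainEval {ι : Type*} [TopologicalSpace ι] (u : ℕ → M) {ρ : ι → ℝ}
    (hρ : Continuous ρ) (h0 : ∀ t, 0 ≤ ρ t) (θ : C(unitInterval, M)) :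
    Continuous fun t => chainEval u (ρ t) θ := by
  have hnode : ∀ i, Continuous fun t => evalNode (ρ t) i := fun i =>
    continuous_projIcc.comp ((continuous_const.sub hρ).div (hρ.add continuous_const)
      fun t => by have := h0 t; positivity)
  rw [continuous_iff_continuousAt]
  intro t₀
  have hev : ∀ᶠ t in 𝓝 t₀, chainEval u (ρ t) θ
      = θ 0 + ∑ i ∈ Finset.range (2 * ⌊ρ t₀ + 1⌋₊ + 3),
        (1 - u i) * (θ (evalNode (ρ t) (i + 1)) - θ (evalNode (ρ t) i)) := by
    have : ∀ᶠ t in 𝓝 t₀, ρ t < ρ t₀ + 1 :=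
      hρ.continuousAt.eventually_lt continuousAt_const (by linarith)
    filter_upwards [this] with t ht
    refine chainEval_eq u (h0 t) θ ?_
    have := Nat.floor_le_floor ht.le
    omega
  refine ContinuousAt.congr ?_ (hev.mono fun t ht => ht.symm)
  refine Continuous.continuousAt ?_
  refine continuous_const.add (continuous_finsetSum _ fun i _ => continuous_const.mul ?_)
  exact (θ.continuous.comp (hnode _)).sub (θ.continuous.comp (hnode _))

theorem chainEval_sub_mem {J : Submodule ℂ M} {u : ℕ → M} (hu : ∀ i (m : M), u i * m ∈ J) {r : ℝ}
    (hr : 0 ≤ r) (θ : C(unitInterval, M)) : chainEval u r θ - θ 1 ∈ J := by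
  have h : chainEval u r θ - θ 1 = - ∑ i ∈ Finset.range (2 * ⌊r⌋₊ + 3),
      u i * (θ (evalNode r (i + 1)) - θ (evalNode r i)) := by
    have tel := Finset.sum_range_sub (fun i => θ (evalNode r i)) (2 * ⌊r⌋₊ + 3)
    rw [evalNode_eq_one hr lt_of_floor_index, evalNode_eq_zero hr (by simpa using hr)] at tel
    simp only [chainEval, sub_mul, one_mul, Finset.sum_sub_distrib (fun i => θ _ - θ _)]
    rw [tel]
    abel
  rw [h]
  exact J.neg_mem (J.sum_mem fun i _ => hu i _)

/-- The rate of the error terms of `chainEval`. -/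
def chainRate (n : ℕ) : ℝ := (2 * n + 4) ^ 2 * (1 / 4 : ℝ) ^ (n - 1)

theorem chainRate_nonneg (n : ℕ) : 0 ≤ chainRate n := by unfold chainRate; positivity

theorem tendsto_chainRate : Tendsto chainRate atTop (𝓝 0) := by
  have h2 := tendsto_pow_const_mul_const_pow_of_lt_one 2 (r := (1 / 4 : ℝ)) (by norm_num) (by norm_num)
  have h1 := tendsto_pow_const_mul_const_pow_of_lt_one 1 (r := (1 / 4 : ℝ)) (by norm_num) (by norm_num)
  have h0 := tendsto_pow_const_mul_const_pow_of_lt_one 0 (r := (1 / 4 : ℝ)) (by norm_num) (by norm_num)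
  have h := ((h2.const_mul 16).add (h1.const_mul 64)).add (h0.const_mul 64)
  simp only [mul_zero, add_zero] at h
  refine h.congr' ?_
  filter_upwards [eventually_ge_atTop 1] with n hn
  obtain ⟨m, rfl⟩ : ∃ m, n = m + 1 := ⟨n - 1, by omega⟩
  simp only [chainRate, Nat.add_sub_cancel]
  push_cast
  ring

theorem tendsto_chainRate_floor (c : ℝ) :
    Tendsto (fun r : ℝ => c * chainRate ⌊r⌋₊) atTop (𝓝 0) := by
  simpa using (tendsto_chainRate.comp (tendsto_nat_floor_atTop (α := ℝ))).const_mul c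

theorem norm_chainEval_terms_le {n : ℕ} {r : ℝ} (hr : 0 ≤ r) (hn : n = ⌊r⌋₊)
    (θ : C(unitInterval, M)) (g : ℕ → M → M) (hg : ∀ i, g i 0 = 0) {C : ℝ} (hC : 0 ≤ C)
    (h : ∀ i, n ≤ i → r ≤ i + 1 →
      ‖g i (θ (evalNode r (i + 1)) - θ (evalNode r i))‖ ≤ C * (1 / 4 : ℝ) ^ i) :
    ‖∑ i ∈ Finset.range (2 * n + 3), g i (θ (evalNode r (i + 1)) - θ (evalNode r i))‖
      ≤ C * chainRate n := by
  have hterm : ∀ i ∈ Finset.range (2 * n + 3),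
      ‖g i (θ (evalNode r (i + 1)) - θ (evalNode r i))‖ ≤ C * (1 / 4 : ℝ) ^ n := by
    intro i _
    by_cases hi : (i : ℝ) + 1 ≤ r
    · rw [evalNode_eq_zero hr (by push_cast; exact hi), evalNode_eq_zero hr (by linarith), sub_self,
        hg, norm_zero]
      positivity
    · push Not at hi
      have hni : n ≤ i := by
        rw [hn, ← Nat.lt_add_one_iff]
        exact (Nat.floor_lt hr).mpr (by push_cast; exact hi)
      refine (h i hni hi.le).trans ?_
      gcongr ?_ * ?_
      exact pow_le_pow_of_le_one (by norm_num) (by norm_num) hni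
  refine (norm_sum_le_of_le _ hterm).trans ?_
  rw [Finset.sum_const, Finset.card_range, nsmul_eq_mul, chainRate]
  have h1 : (1 / 4 : ℝ) ^ n ≤ (1 / 4 : ℝ) ^ (n - 1) :=
    pow_le_pow_of_le_one (by norm_num) (by norm_num) (Nat.sub_le _ _)
  have h2 : ((2 * n + 3 : ℕ) : ℝ) ≤ (2 * n + 4) ^ 2 := by
    push_cast
    nlinarith [(Nat.cast_nonneg n : (0 : ℝ) ≤ n)]
  calc _ = C * (((2 * n + 3 : ℕ) : ℝ) * (1 / 4 : ℝ) ^ n) := by ring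
    _ ≤ C * ((2 * n + 4) ^ 2 * (1 / 4 : ℝ) ^ (n - 1)) := by gcongr

/-- `u` asymptotically commutes with all values of `θ`. -/
def AsympCommutes (u : ℕ → M) (θ : C(unitInterval, M)) : Prop :=
  ∃ j, ∀ i, j ≤ i → ∀ s, ‖u i * θ s - θ s * u i‖ ≤ (1 / 4 : ℝ) ^ i

theorem norm_commutator_sub_le {u a b : M} {c : ℝ} (ha : ‖u * a - a * u‖ ≤ c)
    (hb : ‖u * b - b * u‖ ≤ c) : ‖u * (a - b) - (a - b) * u‖ ≤ 2 * c := by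
  have : u * (a - b) - (a - b) * u = (u * a - a * u) - (u * b - b * u) := by noncomm_ring
  rw [this]
  calc _ ≤ _ := norm_sub_le _ _
    _ ≤ c + c := add_le_add ha hb
    _ = _ := by ring

theorem ContinuousMap.norm_apply_sub_apply_le (θ : C(unitInterval, M)) (s s' : unitInterval) :
    ‖θ s - θ s'‖ ≤ 2 * ‖θ‖ :=
  calc _ ≤ ‖θ s‖ + ‖θ s'‖ := norm_sub_le _ _
    _ ≤ ‖θ‖ + ‖θ‖ := add_le_add (θ.norm_coe_le_norm s) (θ.norm_coe_le_norm s')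
    _ = _ := by ring

theorem tendsto_star_chainEval {u : ℕ → M} (hu : ∀ i, star (u i) = u i) {θ : C(unitInterval, M)}
    (hθ : AsympCommutes u θ) :
    Tendsto (fun r => star (chainEval u r θ) - chainEval u r (star θ)) atTop (𝓝 0) := by
  obtain ⟨j, hj⟩ := hθ
  refine squeeze_zero_norm' ?_ (tendsto_chainRate_floor 2)
  filter_upwards [eventually_ge_atTop 0, eventually_ge_atTop (j : ℝ)] with r hr hrj
  have hn : j ≤ ⌊r⌋₊ := Nat.le_floor hrj
  have e : star (chainEval u r θ) - chainEval u r (star θ)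
      = ∑ i ∈ Finset.range (2 * ⌊r⌋₊ + 3), (fun x => - star (u i * x - x * u i))
        (θ (evalNode r (i + 1)) - θ (evalNode r i)) := by
    simp only [chainEval, star_add, star_sum, ContinuousMap.star_apply]
    rw [add_sub_add_left_eq_sub, ← Finset.sum_sub_distrib]
    refine Finset.sum_congr rfl fun i _ => ?_
    simp only [star_mul, star_sub, star_one, hu]
    noncomm_ring
  rw [e]
  refine norm_chainEval_terms_le hr rfl θ (fun i x => - star (u i * x - x * u i)) (by simp)
    (by norm_num) fun i hi _ => ?_
  simp only [norm_neg, norm_star]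
  exact norm_commutator_sub_le (hj i (hn.trans hi) _) (hj i (hn.trans hi) _)

theorem tendsto_chainEval_sub_zero {u : ℕ → M} {δ : C(unitInterval, M)}
    (hδ : ∃ j, ∀ i, j ≤ i → ∀ s, ‖(1 - u i) * δ s‖ ≤ (1 / 4 : ℝ) ^ i) :
    Tendsto (fun r => chainEval u r δ - δ 0) atTop (𝓝 0) := by
  obtain ⟨j, hj⟩ := hδ
  refine squeeze_zero_norm' ?_ (tendsto_chainRate_floor 2)
  filter_upwards [eventually_ge_atTop 0, eventually_ge_atTop (j : ℝ)] with r hr hrj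
  have hn : j ≤ ⌊r⌋₊ := Nat.le_floor hrj
  rw [chainEval, add_sub_cancel_left]
  refine norm_chainEval_terms_le hr rfl δ (fun i x => (1 - u i) * x) (by simp)
    (by norm_num) fun i hi _ => ?_
  rw [mul_sub]
  calc _ ≤ _ := norm_sub_le _ _
    _ ≤ (1 / 4 : ℝ) ^ i + (1 / 4 : ℝ) ^ i :=
      add_le_add (hj i (hn.trans hi) _) (hj i (hn.trans hi) _)
    _ = _ := by ring

theorem norm_chainEval_sub_zero_mul_le {u : ℕ → M} {θ : C(unitInterval, M)} {j : ℕ}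
    (hj : ∀ i, j ≤ i → ∀ s, ‖u i * θ s - θ s * u i‖ ≤ (1 / 4 : ℝ) ^ i) {r : ℝ} (hr : 0 ≤ r)
    (hrj : (j : ℝ) ≤ r) {b : M}
    (hb : ∀ i : ℕ, j ≤ i → r ≤ i + 1 →
      ‖(1 - u i) * b‖ ≤ (1 / 4 : ℝ) ^ i ∧ ‖b * (1 - u i)‖ ≤ (1 / 4 : ℝ) ^ i) :
    ‖(chainEval u r θ - θ 0) * b‖ ≤ 2 * (‖θ‖ + ‖b‖) * chainRate ⌊r⌋₊ ∧
      ‖b * (chainEval u r θ - θ 0)‖ ≤ 2 * (‖θ‖ + ‖b‖) * chainRate ⌊r⌋₊ := by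
  have hn : j ≤ ⌊r⌋₊ := Nat.le_floor hrj
  rw [chainEval, add_sub_cancel_left, Finset.sum_mul, Finset.mul_sum]
  constructor
  · refine norm_chainEval_terms_le hr rfl θ (fun i x => (1 - u i) * x * b) (by simp)
      (by positivity) fun i hi hri => ?_
    set x := θ (evalNode r (i + 1)) - θ (evalNode r i)
    have e : (1 - u i) * x * b = x * ((1 - u i) * b) - (u i * x - x * u i) * b := by noncomm_ring
    have hx : ‖u i * x - x * u i‖ ≤ 2 * (1 / 4 : ℝ) ^ i :=
      norm_commutator_sub_le (hj i (hn.trans hi) _) (hj i (hn.trans hi) _)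
    rw [e]
    calc _ ≤ ‖x‖ * ‖(1 - u i) * b‖ + ‖u i * x - x * u i‖ * ‖b‖ :=
          (norm_sub_le _ _).trans (add_le_add (norm_mul_le _ _) (norm_mul_le _ _))
      _ ≤ 2 * ‖θ‖ * (1 / 4 : ℝ) ^ i + 2 * (1 / 4 : ℝ) ^ i * ‖b‖ := by
        gcongr
        · exact ContinuousMap.norm_apply_sub_apply_le _ _ _
        · exact (hb i (hn.trans hi) hri).1
      _ = _ := by ring
  · refine norm_chainEval_terms_le hr rfl θ (fun i x => b * ((1 - u i) * x)) (by simp)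
      (by positivity) fun i hi hri => ?_
    set x := θ (evalNode r (i + 1)) - θ (evalNode r i)
    rw [← mul_assoc]
    have hb0 : 0 ≤ ‖b‖ * (1 / 4 : ℝ) ^ i := by positivity
    calc _ ≤ ‖b * (1 - u i)‖ * ‖x‖ := norm_mul_le _ _
      _ ≤ (1 / 4 : ℝ) ^ i * (2 * ‖θ‖) := by
        gcongr
        · exact (hb i (hn.trans hi) hri).2
        · exact ContinuousMap.norm_apply_sub_apply_le _ _ _
      _ ≤ _ := by linarith

end Eval

section EvalMul

variable {M : Type*} [CStarAlgebra M] [PartialOrder M] [StarOrderedRing M]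

theorem norm_chainIncr_commutator_le {M : Type*} [CStarAlgebra M] {u : ℕ → M} {n k : ℕ} {m : M} {c : ℝ} (hk : 0 < k)
    (hc : 0 ≤ c) (h : ∀ i, k ≤ i + 1 → ‖u i * m - m * u i‖ ≤ c) :
    ‖m * chainIncr u n k - chainIncr u n k * m‖ ≤ 2 * c := by
  have h1 : ‖m * (if k < n then u k else 1) - (if k < n then u k else 1) * m‖ ≤ c := by
    split_ifs
    · rw [norm_sub_rev]
      exact h k (by omega)
    · simpa
  have h2 : ‖m * u (k - 1) - u (k - 1) * m‖ ≤ c := by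
    rw [norm_sub_rev]
    exact h (k - 1) (by omega)
  have e : m * chainIncr u n k - chainIncr u n k * m
      = (m * (if k < n then u k else 1) - (if k < n then u k else 1) * m)
        - (m * u (k - 1) - u (k - 1) * m) := by
    unfold chainIncr
    rw [if_neg hk.ne']
    noncomm_ring
  rw [e]
  calc _ ≤ _ := norm_sub_le _ _
    _ ≤ c + c := add_le_add h1 h2
    _ = _ := by ring

theorem tendsto_chainEval_mul {u : ℕ → M} (hu0 : ∀ i, 0 ≤ u i) (hu1 : ∀ i, u i ≤ 1)
    (hmono : ∀ i j, i < j → u i ≤ u j)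
    (horth : ∀ i j, i < j → ‖(1 - u j) * u i‖ ≤ (1 / 4 : ℝ) ^ j)
    {θ θ' : C(unitInterval, M)} (hθ : AsympCommutes u θ) (hθ' : AsympCommutes u θ') :
    Tendsto (fun r => chainEval u r θ * chainEval u r θ' - chainEval u r (θ * θ')) atTop (𝓝 0) := by
  obtain ⟨j₁, hj₁⟩ := hθ
  obtain ⟨j₂, hj₂⟩ := hθ'
  set Cη : ℝ := 8 * (‖θ‖ + 1) * (‖θ'‖ + 1) with hCη
  have hCη0 : 0 ≤ Cη := by positivity
  have hstar : ∀ i, star (u i) = u i := fun i => (IsSelfAdjoint.of_nonneg (hu0 i)).star_eq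
  have horth' : ∀ i j, i < j → ‖u i * (1 - u j)‖ ≤ (1 / 4 : ℝ) ^ j := by
    intro i j hij
    have := horth i j hij
    rw [← norm_star] at this
    simpa [hstar] using this
  rw [Metric.tendsto_nhds]
  intro ε hε
  set ω : ℝ := ε / 4 / (‖θ‖ + 1) with hω
  have hω0 : 0 < ω := by positivity
  obtain ⟨d, hd0, hd⟩ := Metric.uniformContinuous_iff.mp
    (CompactSpace.uniformContinuous_of_continuous θ'.continuous) ω hω0
  have hinv : ∀ᶠ r : ℝ in atTop, (r + 1)⁻¹ < d :=
    (tendsto_inv_atTop_zero.comp (tendsto_atTop_add_const_right _ (1 : ℝ) tendsto_id)).eventually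
      (gt_mem_nhds hd0)
  have hrate : ∀ᶠ r : ℝ in atTop, Cη * chainRate ⌊r⌋₊ < ε / 2 :=
    (tendsto_chainRate_floor Cη).eventually (gt_mem_nhds (by positivity))
  filter_upwards [eventually_ge_atTop 1, eventually_ge_atTop ((j₁ + 1 : ℕ) : ℝ),
    eventually_ge_atTop ((j₂ + 1 : ℕ) : ℝ), hinv, hrate] with r hr1 hrj₁ hrj₂ hrd hrr
  have hr : 0 ≤ r := by linarith
  rw [dist_zero_right]
  have hnj₁ : j₁ + 1 ≤ ⌊r⌋₊ := Nat.le_floor hrj₁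
  have hnj₂ : j₂ + 1 ≤ ⌊r⌋₊ := Nat.le_floor hrj₂
  rw [chainEval_eq_sum u hr, chainEval_eq_sum u hr, chainEval_eq_sum u hr]
  set n := ⌊r⌋₊ with hn
  set p := chainIncr u (2 * n + 3) with hp
  set x : ℕ → M := fun k => θ (evalNode r k) with hx
  set x' : ℕ → M := fun k => θ' (evalNode r k) with hx'
  have hps : ∑ k ∈ Finset.range (2 * n + 3 + 1), p k = 1 := sum_chainIncr u _
  have hp0 : ∀ k, 0 ≤ p k := chainIncr_nonneg hmono hu0 hu1 _
  have hp1 : ∀ k < 2 * n + 3 + 1, ‖p k‖ ≤ 1 := by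
    intro k hk
    refine (CStarAlgebra.norm_le_one_iff_of_nonneg _ (hp0 k)).mpr ?_
    rw [← hps]
    exact Finset.single_le_sum (fun i _ => hp0 i) (Finset.mem_range.mpr hk)
  have hxn : ∀ k, ‖x k‖ ≤ ‖θ‖ := fun k => θ.norm_coe_le_norm _
  have hΔ : ∀ k l, ‖x' l - x' k‖ ≤ 2 * ‖θ'‖ := fun k l =>
    ContinuousMap.norm_apply_sub_apply_le _ _ _
  have hsmall : ∀ k, ‖x' (k + 1) - x' k‖ ≤ ω := by
    intro k
    rw [← dist_eq_norm]
    exact (hd ((dist_evalNode_succ_le hr k).trans_lt hrd)).le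
  have hzero : ∀ k, k ≤ n → evalNode r k = 0 := fun k hk =>
    evalNode_eq_zero hr (le_trans (by exact_mod_cast hk) (Nat.floor_le hr))
  have hxz : ∀ k l, k ≤ n → l ≤ n → x' l - x' k = 0 := fun k l hk hl => by
    simp only [hx', hzero k hk, hzero l hl, sub_self]
  have hprod : (∑ k ∈ Finset.range (2 * n + 3 + 1), p k * x k)
        * (∑ l ∈ Finset.range (2 * n + 3 + 1), p l * x' l)
      - ∑ k ∈ Finset.range (2 * n + 3 + 1), p k * (x k * x' k)
      = ∑ k ∈ Finset.range (2 * n + 3 + 1), ∑ l ∈ Finset.range (2 * n + 3 + 1),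
        p k * x k * (p l * (x' l - x' k)) := by
    have e : ∀ k, p k * (x k * x' k)
        = p k * x k * (∑ l ∈ Finset.range (2 * n + 3 + 1), p l) * x' k := by
      intro k
      rw [hps, mul_one, mul_assoc]
    simp only [e, Finset.sum_mul, Finset.mul_sum, mul_sub, Finset.sum_sub_distrib, mul_assoc]
    rw [Finset.sum_comm]
  have hgoal : ‖∑ k ∈ Finset.range (2 * n + 3 + 1), ∑ l ∈ Finset.range (2 * n + 3 + 1),
        p k * x k * (p l * (x' l - x' k))‖ < ε := by
    have hpow : ∀ j, n - 1 ≤ j → (1 / 4 : ℝ) ^ j ≤ (1 / 4 : ℝ) ^ (n - 1) := fun j hj =>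
      pow_le_pow_of_le_one (by norm_num) (by norm_num) hj
    set q : ℝ := (1 / 4 : ℝ) ^ (n - 1) with hq
    have hq0 : 0 ≤ q := by positivity
    have hη0 : 0 ≤ Cη * q := by positivity
    have hfar : ∀ k < 2 * n + 3 + 1, ∀ l < 2 * n + 3 + 1, k + 2 ≤ l ∨ l + 2 ≤ k →
        n + 1 ≤ max k l → ‖p k * x k * p l‖ ≤ 4 * ((‖θ‖ + 1) * q) := by
      intro k hk l hl hkl hmax
      rcases hkl with hkl | hkl
      · refine norm_chainIncr_mul_mul_le hkl (by omega) fun i j hij hj => ?_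
        have e : u i * x k * (1 - u j) = u i * (1 - u j) * x k + u i * (u j * x k - x k * u j) := by
          noncomm_ring
        rw [e]
        have hui : ‖u i‖ ≤ 1 := (CStarAlgebra.norm_le_one_iff_of_nonneg _ (hu0 i)).mpr (hu1 i)
        calc _ ≤ ‖u i * (1 - u j)‖ * ‖x k‖ + ‖u i‖ * ‖u j * x k - x k * u j‖ :=
              (norm_add_le _ _).trans (add_le_add (norm_mul_le _ _) (norm_mul_le _ _))
          _ ≤ q * ‖θ‖ + 1 * q := by
            gcongr
            · exact (horth' i j hij).trans (hpow j (by omega))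
            · exact hxn k
            · exact (hj₁ j (by omega) _).trans (hpow j (by omega))
          _ = _ := by ring
      · refine norm_chainIncr_mul_mul_le' hkl (by omega) fun i j hij hj => ?_
        have e : (1 - u j) * x k * u i = x k * ((1 - u j) * u i) - (u j * x k - x k * u j) * u i := by
          noncomm_ring
        rw [e]
        have hui : ‖u i‖ ≤ 1 := (CStarAlgebra.norm_le_one_iff_of_nonneg _ (hu0 i)).mpr (hu1 i)
        calc _ ≤ ‖x k‖ * ‖(1 - u j) * u i‖ + ‖u j * x k - x k * u j‖ * ‖u i‖ :=
              (norm_sub_le _ _).trans (add_le_add (norm_mul_le _ _) (norm_mul_le _ _))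
          _ ≤ ‖θ‖ * q + q * 1 := by
            gcongr
            · exact hxn k
            · exact (horth i j hij).trans (hpow j (by omega))
            · exact (hj₁ j (by omega) _).trans (hpow j (by omega))
          _ = _ := by ring
    refine (norm_sum_sum_le_of_tridiagonal (C := ‖θ‖ * ω) (η := Cη * q) p hp0 hps
      (fun k l => x k * (x' l - x' k)) _ (by positivity) ?_ ?_ ?_).trans_lt ?_
    · intro k _
      exact (norm_mul_le _ _).trans (by gcongr; exacts [hxn k, hsmall k])
    · intro k _
      refine (norm_mul_le _ _).trans (mul_le_mul (hxn _) ?_ (norm_nonneg _) (norm_nonneg _))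
      rw [norm_sub_rev]
      exact hsmall k
    · intro k hk l hl
      by_cases hmax : max k l ≤ n
      · rw [hxz k l (by omega) (by omega)]
        simpa using hη0
      have hmax' : n + 1 ≤ max k l := by omega
      split_ifs with hkl
      · have hcomm : ‖(x' l - x' k) * p l - p l * (x' l - x' k)‖ ≤ 2 * (2 * q) := by
          refine norm_chainIncr_commutator_le (by omega) (by positivity) fun i hi => ?_
          refine norm_commutator_sub_le ?_ ?_
          · exact (hj₂ i (by omega) _).trans (hpow i (by omega))
          · exact (hj₂ i (by omega) _).trans (hpow i (by omega))
        have e : p k * x k * (p l * (x' l - x' k)) - p k * (x k * (x' l - x' k)) * p l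
            = - (p k * x k * ((x' l - x' k) * p l - p l * (x' l - x' k))) := by noncomm_ring
        rw [e, norm_neg]
        calc _ ≤ ‖p k‖ * ‖x k‖ * ‖(x' l - x' k) * p l - p l * (x' l - x' k)‖ :=
              (norm_mul_le _ _).trans (by gcongr; exact norm_mul_le _ _)
          _ ≤ 1 * ‖θ‖ * (2 * (2 * q)) := by
            gcongr
            · exact hp1 k hk
            · exact hxn k
          _ ≤ Cη * q := by
            rw [hCη]
            have : 0 ≤ ‖θ‖ * q := by positivity
            have : 0 ≤ ‖θ'‖ * q := by positivity
            have : 0 ≤ ‖θ‖ * ‖θ'‖ * q := by positivity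
            nlinarith
      · rw [sub_zero]
        rcases eq_or_ne k l with rfl | hne
        · simpa using hη0
        · rw [← mul_assoc]
          calc _ ≤ ‖p k * x k * p l‖ * ‖x' l - x' k‖ := norm_mul_le _ _
            _ ≤ 4 * ((‖θ‖ + 1) * q) * (2 * ‖θ'‖) := by
              gcongr
              · exact hfar k hk l hl (by omega) hmax'
              · exact hΔ k l
            _ ≤ Cη * q := by
              rw [hCη]
              have : 0 ≤ (‖θ‖ + 1) * q := by positivity
              nlinarith
    · have h1 : ‖θ‖ * ω ≤ ε / 4 := by
        rw [hω, ← mul_div_assoc, div_le_iff₀ (by positivity)]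
        nlinarith [norm_nonneg θ]
      have h2 : (((2 * n + 3 : ℕ) : ℝ) + 1) ^ 2 * (Cη * q) = Cη * chainRate n := by
        rw [chainRate]
        push_cast
        ring
      rw [h2]
      linarith
  rw [← hprod] at hgoal
  exact hgoal

end EvalMul

section AsympHom

/-- A subset of a C⋆-algebra that is closed under the algebraic operations, under scalars from `C₀`,
and under the operation `a ↦ 1 - √(1 - a⋆a)` on contractions. -/
structure AdmissibleSet {A : Type*} [NonUnitalCStarAlgebra A] (A₀ : Set A) (C₀ : Set ℂ) : Prop where
  mul_mem : ∀ a ∈ A₀, ∀ b ∈ A₀, a * b ∈ A₀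
  add_mem : ∀ a ∈ A₀, ∀ b ∈ A₀, a + b ∈ A₀
  star_mem : ∀ a ∈ A₀, star a ∈ A₀
  smul_mem : ∀ c ∈ C₀, ∀ a ∈ A₀, c • a ∈ A₀
  exists_defect : ∀ a ∈ A₀, ‖a‖ < 1 → ∃ d ∈ A₀, star d = d ∧ star a * a + d * d = d + d
  ratCast_mem : ∀ q : ℚ, (q : ℂ) ∈ C₀

theorem exists_defect {A : Type*} [NonUnitalCStarAlgebra A] {a : A} (ha : ‖a‖ < 1) :
    ∃ d : A, star d = d ∧ star a * a + d * d = d + d := by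
  let _ := CStarAlgebra.spectralOrder A
  let _ := CStarAlgebra.spectralOrderedRing A
  have hsa : IsSelfAdjoint (star a * a) := IsSelfAdjoint.star_mul_self a
  set f : ℝ → ℝ := fun x => 1 - √(1 - x) with hf
  have hfc : Continuous f := by fun_prop
  have hf0 : f 0 = 0 := by simp [hf]
  refine ⟨cfcₙ f (star a * a), ?_, ?_⟩
  · exact (cfcₙ_predicate f (star a * a) : IsSelfAdjoint _).star_eq
  · have hid : star a * a = cfcₙ (fun x : ℝ => x) (star a * a) := (cfcₙ_id' ℝ (star a * a)).symm
    have h1 : star a * a + cfcₙ f (star a * a) * cfcₙ f (star a * a)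
        = cfcₙ (fun x : ℝ => x + f x * f x) (star a * a) := by
      rw [cfcₙ_add (a := star a * a) (fun x : ℝ => x) (fun x => f x * f x)
        (by fun_prop) rfl ((hfc.mul hfc).continuousOn) (by simp [hf0]),
        cfcₙ_mul f f (star a * a) hfc.continuousOn hf0 hfc.continuousOn hf0, ← hid]
    rw [h1, ← cfcₙ_add (a := star a * a) f f hfc.continuousOn hf0 hfc.continuousOn hf0]
    refine cfcₙ_congr fun x hx => ?_
    have hxn : ‖x‖ ≤ ‖star a * a‖ := NonUnitalIsometricContinuousFunctionalCalculus.norm_quasispectrum_le (𝕜 := ℝ) (star a * a) hx hsa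
    have hx1 : x ≤ 1 := by
      refine (le_abs_self x).trans (hxn.trans ?_)
      rw [CStarRing.norm_star_mul_self]
      nlinarith [norm_nonneg a]
    have hs := Real.mul_self_sqrt (show 0 ≤ 1 - x by linarith)
    simp only [hf]
    linarith

theorem admissibleSet_univ {A : Type*} [NonUnitalCStarAlgebra A] :
    AdmissibleSet (Set.univ : Set A) Set.univ where
  mul_mem := by simp
  add_mem := by simp
  star_mem := by simp
  smul_mem := by simp
  exists_defect a _ ha := by simpa using exists_defect ha
  ratCast_mem := by simp

/-- `F` is asymptotically a ⋆-homomorphism along `l` on the set `A₀`, with scalars from `C₀`. -/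
structure AsympHomOn {A M ι : Type*} [NonUnitalCStarAlgebra A] [CStarAlgebra M] (l : Filter ι)
    (A₀ : Set A) (C₀ : Set ℂ) (F : ι → A → M) : Prop where
  mul : ∀ a ∈ A₀, ∀ b ∈ A₀, Tendsto (fun t => F t (a * b) - F t a * F t b) l (𝓝 0)
  add : ∀ a ∈ A₀, ∀ b ∈ A₀, Tendsto (fun t => F t (a + b) - (F t a + F t b)) l (𝓝 0)
  smul : ∀ c ∈ C₀, ∀ a ∈ A₀, Tendsto (fun t => F t (c • a) - c • F t a) l (𝓝 0)
  map_star : ∀ a ∈ A₀, Tendsto (fun t => F t (star a) - star (F t a)) l (𝓝 0)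

/-- `T` is a ⋆-homomorphism modulo `J`. -/
structure RepMod {A M : Type*} [NonUnitalCStarAlgebra A] [CStarAlgebra M] (J : Submodule ℂ M)
    (T : A → M) : Prop where
  mul : ∀ a b, T (a * b) - T a * T b ∈ J
  add : ∀ a b, T (a + b) - (T a + T b) ∈ J
  smul : ∀ (c : ℂ) a, T (c • a) - c • T a ∈ J
  map_star : ∀ a, T (star a) - star (T a) ∈ J

variable {A M ι : Type*} [NonUnitalCStarAlgebra A] [CStarAlgebra M] {l : Filter ι}
  {A₀ : Set A} {C₀ : Set ℂ} {F : ι → A → M} {J : Submodule ℂ M}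

theorem defect_identity (x y xs s dd t : M) :
    star x * x + star (1 - y) * (1 - y)
      = 1 + ((t - (y + y)) - (t - (s + dd)) - (s - xs * x) - (dd - y * y))
        - (xs - star x) * x + (y - star y) * (1 - y) := by
  simp only [star_sub, star_one]
  noncomm_ring

theorem norm_sq_le_norm_star_mul_self_add [PartialOrder M] [StarOrderedRing M] (x z : M) :
    ‖x‖ ^ 2 ≤ ‖star x * x + star z * z‖ := by
  rw [pow_two, ← CStarRing.norm_star_mul_self]
  exact CStarAlgebra.norm_le_norm_of_nonneg_of_le (star_mul_self_nonneg x)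
    (le_add_of_nonneg_right (star_mul_self_nonneg z))

theorem norm_one_le_of_cstar : ‖(1 : M)‖ ≤ 1 := by
  have h := CStarRing.norm_star_mul_self (x := (1 : M))
  rw [star_one, mul_one] at h
  nlinarith [norm_nonneg (1 : M)]

theorem AsympHomOn.eventually_norm_le_one_add [PartialOrder M] [StarOrderedRing M]
    (hF : AsympHomOn l A₀ C₀ F) (hA₀ : AdmissibleSet A₀ C₀) {a : A} (ha : a ∈ A₀) (ha1 : ‖a‖ < 1)
    {ε : ℝ} (hε : 0 < ε) : ∀ᶠ t in l, ‖F t a‖ ≤ 1 + ε := by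
  obtain ⟨d, hd, hds, hdd⟩ := hA₀.exists_defect a ha ha1
  have hsa := hA₀.star_mem a ha
  have h1 := hF.map_star d hd
  rw [hds] at h1
  have h2 := hF.map_star a ha
  have h3 := hF.mul _ hsa a ha
  have h4 := hF.mul d hd d hd
  have h5 := hF.add _ (hA₀.mul_mem _ hsa a ha) _ (hA₀.mul_mem d hd d hd)
  rw [hdd] at h5
  have h6 := hF.add d hd d hd
  have h0 := ((h6.sub h5).sub h3).sub h4
  simp only [sub_zero] at h0
  have small : ∀ {g : ι → M}, Tendsto g l (𝓝 0) → ∀ᶠ t in l, ‖g t‖ < ε / 3 := fun hg =>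
    (tendsto_zero_iff_norm_tendsto_zero.mp hg).eventually (gt_mem_nhds (by positivity))
  filter_upwards [small h0, small h1, small h2] with t k0 k1 k2
  have id := defect_identity (F t a) (F t d) (F t (star a)) (F t (star a * a)) (F t (d * d))
    (F t (d + d))
  have hn : ‖star (F t a) * F t a + star (1 - F t d) * (1 - F t d)‖
      ≤ 1 + ε / 3 + ε / 3 * ‖F t a‖ + ε / 3 * ‖1 - F t d‖ := by
    rw [id]
    refine (norm_add_le _ _).trans (add_le_add ((norm_sub_le _ _).trans (add_le_add
      ((norm_add_le _ _).trans (add_le_add ?_ k0.le)) ?_)) ?_)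
    · exact norm_one_le_of_cstar
    · exact (norm_mul_le _ _).trans (by gcongr)
    · exact (norm_mul_le _ _).trans (by gcongr)
  have hx := (norm_sq_le_norm_star_mul_self_add (F t a) (1 - F t d)).trans hn
  have hz := (norm_sq_le_norm_star_mul_self_add (1 - F t d) (F t a)).trans
    ((add_comm (star (1 - F t d) * (1 - F t d)) _) ▸ hn)
  generalize ‖F t a‖ = X at *
  generalize ‖1 - F t d‖ = Z at *
  by_contra! hX
  rcases le_total X Z with h | h
  · nlinarith
  · nlinarith

theorem RepMod.exists_norm_add_lt_two [PartialOrder M] [StarOrderedRing M] (hJ : ApproxIdeal J)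
    {T : A → M} (hT : RepMod J T) {a : A} (ha1 : ‖a‖ < 1) : ∃ b ∈ J, ‖T a + b‖ < 2 := by
  obtain ⟨d, hds, hdd⟩ := exists_defect ha1
  have h1 := hT.map_star d
  rw [hds] at h1
  have h2 := hT.map_star a
  have h3 := hT.mul (star a) a
  have h4 := hT.mul d d
  have h5 := hT.add (star a * a) (d * d)
  rw [hdd] at h5
  have h6 := hT.add d d
  have id := defect_identity (T a) (T d) (T (star a)) (T (star a * a)) (T (d * d)) (T (d + d))
  set x := T a
  set z := 1 - T d
  obtain ⟨b, hb, hbe⟩ : ∃ b ∈ J, star x * x + star z * z = 1 + b := by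
    refine ⟨star x * x + star z * z - 1, ?_, (add_sub_cancel _ _).symm⟩
    have aux : ∀ p q r : M, 1 + p - q + r - 1 = p - q + r := by intros; abel
    rw [id, aux]
    exact J.add_mem (J.sub_mem (J.sub_mem (J.sub_mem (J.sub_mem h6 h5) h3) h4)
        (hJ.mul_right _ h2)) (hJ.mul_right _ h1)
  obtain ⟨u, huJ, hu0, hu1, -, hu⟩ := hJ.exists_approx {b} ∅ (by simpa using hb) (by simp) 1 one_pos
  have hus := (IsSelfAdjoint.of_nonneg hu0).star_eq
  have hub : ‖(1 - u) * b‖ ≤ 1 := hu b (by simp)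
  have h1u : ‖1 - u‖ ≤ 1 := norm_one_sub_le hu0 (le_one_of_norm_lt hu0 hu1)
  refine ⟨-(x * u), J.neg_mem (hJ.mul_left x huJ), ?_⟩
  have e : x + -(x * u) = x * (1 - u) := by noncomm_ring
  rw [e]
  have h := norm_sq_le_norm_star_mul_self_add (x * (1 - u)) (z * (1 - u))
  have e2 : star (x * (1 - u)) * (x * (1 - u)) + star (z * (1 - u)) * (z * (1 - u))
      = (1 - u) * (1 - u) + (1 - u) * b * (1 - u) := by
    have : star (x * (1 - u)) * (x * (1 - u)) + star (z * (1 - u)) * (z * (1 - u))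
        = (1 - u) * (star x * x + star z * z) * (1 - u) := by
      simp only [star_mul, star_sub, star_one, hus]
      noncomm_ring
    rw [this, hbe]
    noncomm_ring
  rw [e2] at h
  have hle : ‖(1 - u) * (1 - u) + (1 - u) * b * (1 - u)‖ ≤ 1 * 1 + 1 * 1 := by
    refine (norm_add_le _ _).trans (add_le_add ((norm_mul_le _ _).trans ?_)
      ((norm_mul_le _ _).trans ?_)) <;> gcongr
  by_contra! hc
  nlinarith

theorem eventually_norm_lt_of_tendsto_zero {E : Type*} [SeminormedAddCommGroup E] {g : ι → E}
    (hg : Tendsto g l (𝓝 0)) {ε : ℝ} (hε : 0 < ε) : ∀ᶠ t in l, ‖g t‖ < ε :=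
  (tendsto_zero_iff_norm_tendsto_zero.mp hg).eventually (gt_mem_nhds hε)

theorem norm_ratCast_inv_smul_lt_one {a : A} {q : ℚ} (hq : ‖a‖ < q) :
    ‖((q⁻¹ : ℚ) : ℂ) • a‖ < 1 := by
  have hq0 : (0 : ℝ) < q := (norm_nonneg a).trans_lt hq
  have : ‖((q⁻¹ : ℚ) : ℂ)‖ = (q : ℝ)⁻¹ := by
    rw [Complex.norm_ratCast, Rat.cast_inv, abs_of_pos (inv_pos.mpr hq0)]
  rw [norm_smul, this, inv_mul_lt_iff₀ hq0, mul_one]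
  exact hq

theorem norm_lt_of_norm_ratCast_inv_smul_lt {x : M} {q : ℚ} {c : ℝ} (hq0 : (0 : ℝ) < q)
    (h : ‖((q⁻¹ : ℚ) : ℂ) • x‖ < c) : ‖x‖ < q * c := by
  have : ‖((q⁻¹ : ℚ) : ℂ)‖ = (q : ℝ)⁻¹ := by
    rw [Complex.norm_ratCast, Rat.cast_inv, abs_of_pos (inv_pos.mpr hq0)]
  rwa [norm_smul, this, inv_mul_lt_iff₀ hq0] at h

theorem AsympHomOn.eventually_norm_lt [PartialOrder M] [StarOrderedRing M]
    (hF : AsympHomOn l A₀ C₀ F) (hA₀ : AdmissibleSet A₀ C₀) {a : A} (ha : a ∈ A₀) {r : ℝ}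
    (har : ‖a‖ < r) : ∀ᶠ t in l, ‖F t a‖ < 2 * r := by
  obtain ⟨q, hq, hqr⟩ := exists_rat_btwn har
  have hq0 : (0 : ℝ) < q := (norm_nonneg a).trans_lt hq
  have hmem := hA₀.smul_mem _ (hA₀.ratCast_mem q⁻¹) a ha
  filter_upwards [hF.eventually_norm_le_one_add hA₀ hmem (norm_ratCast_inv_smul_lt_one hq)
    (show (0 : ℝ) < 1 / 4 by norm_num), eventually_norm_lt_of_tendsto_zero
      (hF.smul _ (hA₀.ratCast_mem q⁻¹) a ha) (show (0 : ℝ) < 1 / 4 by norm_num)] with t h1 h2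
  have h3 : ‖((q⁻¹ : ℚ) : ℂ) • F t a‖ < 2 := by
    have := norm_sub_norm_le (((q⁻¹ : ℚ) : ℂ) • F t a) (F t (((q⁻¹ : ℚ) : ℂ) • a))
    rw [norm_sub_rev] at this
    linarith
  linarith [norm_lt_of_norm_ratCast_inv_smul_lt hq0 h3]

theorem AsympHomOn.eventually_norm_sub_lt [PartialOrder M] [StarOrderedRing M]
    (hF : AsympHomOn l A₀ C₀ F) (hA₀ : AdmissibleSet A₀ C₀) {a b : A} (ha : a ∈ A₀) (hb : b ∈ A₀)
    {r : ℝ} (har : ‖a - b‖ < r) : ∀ᶠ t in l, ‖F t a - F t b‖ < 3 * r := by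
  have hr : 0 < r := (norm_nonneg _).trans_lt har
  have hneg : ((-1 : ℚ) : ℂ) • b = -b := by simp
  have hnb := hA₀.smul_mem _ (hA₀.ratCast_mem (-1)) b hb
  have h1 := hF.smul _ (hA₀.ratCast_mem (-1)) b hb
  have h2 := hF.add a ha _ hnb
  have hab := hA₀.add_mem a ha _ hnb
  rw [hneg] at h1 h2 hab
  filter_upwards [hF.eventually_norm_lt hA₀ hab (r := r) (by rwa [← sub_eq_add_neg]),
    eventually_norm_lt_of_tendsto_zero h1 (show 0 < r / 4 by positivity),
    eventually_norm_lt_of_tendsto_zero h2 (show 0 < r / 4 by positivity)] with t k0 k1 k2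
  have e : F t a - F t b = F t (a + -b) - (F t (a + -b) - (F t a + F t (-b)))
      - (F t (-b) - ((-1 : ℚ) : ℂ) • F t b) := by
    push_cast
    rw [neg_one_smul]
    abel
  rw [e]
  exact (norm_sub_le_of_le (norm_sub_le_of_le k0.le k2.le) k1.le).trans_lt (by linarith)

theorem RepMod.exists_norm_add_lt [PartialOrder M] [StarOrderedRing M] (hJ : ApproxIdeal J)
    {T : A → M} (hT : RepMod J T) {a : A} {r : ℝ} (har : ‖a‖ < r) :
    ∃ b ∈ J, ‖T a + b‖ < 2 * r := by
  obtain ⟨q, hq, hqr⟩ := exists_rat_btwn har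
  have hq0 : (0 : ℝ) < q := (norm_nonneg a).trans_lt hq
  have hqc : (q : ℂ) ≠ 0 := by
    have : (q : ℝ) ≠ 0 := hq0.ne'
    exact_mod_cast this
  obtain ⟨b, hb, h⟩ := hT.exists_norm_add_lt_two hJ (norm_ratCast_inv_smul_lt_one hq)
  refine ⟨(q : ℂ) • (T (((q⁻¹ : ℚ) : ℂ) • a) - ((q⁻¹ : ℚ) : ℂ) • T a + b),
    J.smul_mem _ (J.add_mem (hT.smul _ _) hb), ?_⟩
  have := norm_lt_of_norm_ratCast_inv_smul_lt (q := q) (c := 2) hq0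
    (x := T a + (q : ℂ) • (T (((q⁻¹ : ℚ) : ℂ) • a) - ((q⁻¹ : ℚ) : ℂ) • T a + b)) (by
      have hc : ((q⁻¹ : ℚ) : ℂ) * (q : ℂ) = 1 := by
        push_cast
        exact inv_mul_cancel₀ hqc
      rw [smul_add, smul_smul, hc, one_smul]
      convert h using 2
      abel)
  linarith

theorem RepMod.exists_norm_sub_add_lt [PartialOrder M] [StarOrderedRing M] (hJ : ApproxIdeal J)
    {T : A → M} (hT : RepMod J T) {a b : A} {r : ℝ} (har : ‖a - b‖ < r) :
    ∃ c ∈ J, ‖T a - T b + c‖ < 2 * r := by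
  obtain ⟨c, hc, h⟩ := hT.exists_norm_add_lt hJ har
  have h1 := hT.smul (-1) b
  have h2 := hT.add a (-b)
  rw [neg_one_smul] at h1
  refine ⟨T (a + -b) - (T a + T (-b)) + (T (-b) - (-1 : ℂ) • T b) + c,
    J.add_mem (J.add_mem h2 h1) hc, ?_⟩
  rw [sub_eq_add_neg] at h
  convert h using 2
  rw [neg_one_smul]
  abel

end AsympHom

section Selection

theorem eventually_comap_atTop_iff {ι : Type*} {ρ : ι → ℝ} {p : ι → Prop} :
    (∀ᶠ t in comap ρ atTop, p t) ↔ ∃ R, ∀ t, R ≤ ρ t → p t := by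
  rw [eventually_comap, eventually_atTop]
  exact ⟨fun ⟨R, h⟩ => ⟨R, fun t ht => h _ ht t rfl⟩, fun ⟨R, h⟩ => ⟨R, fun r hr t ht => h t (ht ▸ hr)⟩⟩

variable {A M ι : Type*} [NonUnitalCStarAlgebra A] [CStarAlgebra M] [TopologicalSpace ι]
  [NormalSpace ι] [ParacompactSpace ι] {ρ : ι → ℝ} {J : Submodule ℂ M}

theorem exists_continuous_correction (hρ : Continuous ρ) {h : ι → M} (hh : Continuous h)
    {g : ℕ → ι → M} (hg : ∀ n, Continuous (g n)) {ε : ℕ → ℝ}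
    (hyp : ∀ N, ∀ᶠ t in comap ρ atTop, ∃ b ∈ J, ∀ n ≤ N, ‖h t + b - g n t‖ < ε n) :
    ∃ k : ι → M, Continuous k ∧ (∀ t, k t - h t ∈ J) ∧
      ∀ n, ∀ᶠ t in comap ρ atTop, ‖k t - g n t‖ < ε n := by
  simp only [eventually_comap_atTop_iff] at hyp
  choose τ₀ hτ₀ using hyp
  let τ : ℕ → ℝ := fun n => max (τ₀ n) n
  let s : ι → Set M := fun x => {b | b ∈ J ∧ ∀ n, τ n + 1 ≤ ρ x → ‖h x + b - g n x‖ < ε n}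
  have hconv : ∀ x, Convex ℝ (s x) := by
    intro x
    have e : s x = (J.restrictScalars ℝ : Set M) ∩
        ⋂ (n : ℕ) (_ : τ n + 1 ≤ ρ x), Metric.ball (g n x - h x) (ε n) := by
      ext b
      simp only [s, Set.mem_ofPred_eq, Set.mem_inter_iff, Set.mem_iInter, Metric.mem_ball,
        dist_eq_norm, SetLike.mem_coe, Submodule.restrictScalars_mem]
      refine and_congr Iff.rfl (forall_congr' fun n => forall_congr' fun _ => ?_)
      rw [show h x + b - g n x = b - (g n x - h x) by abel]
    rw [e]
    exact (J.restrictScalars ℝ).convex.inter (convex_iInter₂ fun n _ => convex_ball _ _)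
  have hloc : ∀ x, ∃ c : M, ∀ᶠ y in 𝓝 x, c ∈ s y := by
    intro x
    have hfin : ∀ n, τ n ≤ ρ x → n ∈ Finset.range (⌊ρ x⌋₊ + 1) := fun n hn =>
      Finset.mem_range_succ_iff.mpr (Nat.le_floor ((le_max_right _ _).trans hn))
    obtain ⟨b, hbJ, hb⟩ : ∃ b ∈ J, ∀ n, τ n ≤ ρ x → ‖h x + b - g n x‖ < ε n := by
      by_cases hne : ((Finset.range (⌊ρ x⌋₊ + 1)).filter fun n => τ n ≤ ρ x).Nonempty
      · set N := Finset.max' _ hne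
        have hN := (Finset.mem_filter.mp (Finset.max'_mem _ hne)).2
        obtain ⟨b, hb, h⟩ := hτ₀ N x ((le_max_left _ _).trans hN)
        exact ⟨b, hb, fun n hn => h n (Finset.le_max' _ _ (Finset.mem_filter.mpr ⟨hfin n hn, hn⟩))⟩
      · refine ⟨0, J.zero_mem, fun n hn => (hne ⟨n, Finset.mem_filter.mpr ⟨hfin n hn, hn⟩⟩).elim⟩
    refine ⟨b, ?_⟩
    have h1 : ∀ᶠ y in 𝓝 x, ρ y < ρ x + 1 :=
      hρ.continuousAt.eventually (gt_mem_nhds (lt_add_one _))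
    have h2 : ∀ᶠ y in 𝓝 x, ∀ n ∈ Finset.range (⌊ρ x⌋₊ + 1), τ n ≤ ρ x →
        ‖h y + b - g n y‖ < ε n := by
      refine (Filter.eventually_all_finset _).mpr fun n _ => ?_
      by_cases hn : τ n ≤ ρ x
      · have hc : ContinuousAt (fun y => ‖h y + b - g n y‖) x :=
          (((hh.add continuous_const).sub (hg n)).norm).continuousAt
        exact (hc.eventually (gt_mem_nhds (hb n hn))).mono fun y hy _ => hy
      · exact Eventually.of_forall fun y h => (hn h).elim
    filter_upwards [h1, h2] with y k1 k2
    exact ⟨hbJ, fun n hn => k2 n (hfin n (by linarith)) (by linarith)⟩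
  obtain ⟨f, hf⟩ := exists_continuous_forall_mem_convex_of_local_const hconv hloc
  refine ⟨fun t => h t + f t, hh.add f.continuous, fun t => ?_, fun n => ?_⟩
  · rw [add_sub_cancel_left]
    exact (hf t).1
  · exact eventually_comap_atTop_iff.mpr ⟨τ n + 1, fun t ht => (hf t).2 n ht⟩

/-- The extension represented by `T` lifts to an asymptotic homomorphism indexed by `ι`. -/
def LiftsAsymp (ρ : ι → ℝ) (J : Submodule ℂ M) (T : A → M) : Prop :=
  ∃ F : ι → A → M, (∀ a, Continuous fun t => F t a) ∧
    AsympHomOn (comap ρ atTop) Set.univ Set.univ F ∧ ∀ t a, F t a - T a ∈ J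

variable [PartialOrder M] [StarOrderedRing M]

theorem tendsto_zero_of_forall_eventually_le {E κ : Type*} [SeminormedAddCommGroup E]
    {l : Filter κ} {g : κ → E} (C : ℝ)
    (h : ∀ r, 0 < r → r < 1 → ∀ᶠ t in l, ‖g t‖ ≤ C * r) : Tendsto g l (𝓝 0) := by
  refine tendsto_zero_iff_norm_tendsto_zero.mpr (Metric.tendsto_nhds.mpr fun ε hε => ?_)
  have hC : 0 < |C| + 1 := by positivity
  have hr : 0 < min (1 / 2) (ε / (|C| + 1) / 2) := by positivity
  filter_upwards [h _ hr ((min_le_left _ _).trans_lt (by norm_num))] with t ht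
  rw [dist_zero_right, norm_norm]
  have h1 : C * min (1 / 2) (ε / (|C| + 1) / 2) ≤ (|C| + 1) * (ε / (|C| + 1) / 2) :=
    mul_le_mul (by linarith [le_abs_self C]) (min_le_right _ _) hr.le hC.le
  have h2 : (|C| + 1) * (ε / (|C| + 1) / 2) = ε / 2 := by field_simp
  linarith

theorem AsympHomOn.extend_of_approx {κ : Type*} {l : Filter κ} {A₀ : Set A} {C₀ : Set ℂ}
    {F F' : κ → A → M} (hF : AsympHomOn l A₀ C₀ F) (hA₀ : AdmissibleSet A₀ C₀)
    (hdA : Dense A₀) (hdC : Dense C₀)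
    (happrox : ∀ a, ∀ a' ∈ A₀, ∀ r, ‖a - a'‖ < r → ∀ᶠ t in l, ‖F' t a - F t a'‖ < 4 * r) :
    AsympHomOn l Set.univ Set.univ F' where
  mul a _ b _ := by
    refine tendsto_zero_of_forall_eventually_le
      (4 + 1 + (4 * (2 * (‖b‖ + 1)) + (2 * (‖a‖ + 1) + 4) * 4)) fun r hr hr1 => ?_
    have hopen : IsOpen {p : A × A | ‖a - p.1‖ < r ∧ ‖b - p.2‖ < r ∧ ‖a * b - p.1 * p.2‖ < r} :=
      IsOpen.and (isOpen_lt (by fun_prop) continuous_const) (IsOpen.and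
        (isOpen_lt (by fun_prop) continuous_const) (isOpen_lt (by fun_prop) continuous_const))
    obtain ⟨⟨a', b'⟩, ⟨h1, h2, h3⟩, ha', hb'⟩ :=
      (hdA.prod hdA).inter_open_nonempty _ hopen ⟨(a, b), by simp [hr]⟩
    simp only at h1 h2 h3 ha' hb'
    have hna : ‖a'‖ < ‖a‖ + 1 := by
      have := norm_sub_norm_le a' a
      rw [norm_sub_rev] at this
      linarith
    have hnb : ‖b'‖ < ‖b‖ + 1 := by
      have := norm_sub_norm_le b' b
      rw [norm_sub_rev] at this
      linarith
    filter_upwards [happrox _ a' ha' r h1, happrox _ b' hb' r h2,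
      happrox _ _ (hA₀.mul_mem a' ha' b' hb') r h3, hF.eventually_norm_lt hA₀ ha' hna,
      hF.eventually_norm_lt hA₀ hb' hnb,
      eventually_norm_lt_of_tendsto_zero (hF.mul a' ha' b' hb') hr] with t k1 k2 k3 k4 k5 k6
    have e : F' t (a * b) - F' t a * F' t b = (F' t (a * b) - F t (a' * b'))
        + (F t (a' * b') - F t a' * F t b')
        - ((F' t a - F t a') * F t b' + F' t a * (F' t b - F t b')) := by noncomm_ring
    have k7 : ‖F' t a‖ ≤ 2 * (‖a‖ + 1) + 4 := by
      have := norm_sub_norm_le (F' t a) (F t a')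
      linarith
    have n1 : ‖(F' t a - F t a') * F t b'‖ ≤ (4 * r) * (2 * (‖b‖ + 1)) :=
      (norm_mul_le _ _).trans (by gcongr)
    have n2 : ‖F' t a * (F' t b - F t b')‖ ≤ (2 * (‖a‖ + 1) + 4) * (4 * r) :=
      (norm_mul_le _ _).trans (by gcongr)
    rw [e]
    refine (norm_sub_le_of_le (norm_add_le_of_le k3.le k6.le) (norm_add_le_of_le n1 n2)).trans
      (le_of_eq (by ring))
  add a _ b _ := by
    refine tendsto_zero_of_forall_eventually_le (8 + 1 + (4 + 4)) fun r hr hr1 => ?_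
    obtain ⟨a', ha', h1⟩ := hdA.exists_dist_lt a hr
    obtain ⟨b', hb', h2⟩ := hdA.exists_dist_lt b hr
    rw [dist_eq_norm] at h1 h2
    have h3 : ‖a + b - (a' + b')‖ < 2 * r := by
      rw [add_sub_add_comm]
      linarith [norm_add_le (a - a') (b - b')]
    filter_upwards [happrox _ a' ha' r h1, happrox _ b' hb' r h2,
      happrox _ _ (hA₀.add_mem a' ha' b' hb') _ h3,
      eventually_norm_lt_of_tendsto_zero (hF.add a' ha' b' hb') hr] with t k1 k2 k3 k6
    have e : F' t (a + b) - (F' t a + F' t b) = (F' t (a + b) - F t (a' + b'))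
        + (F t (a' + b') - (F t a' + F t b'))
        - ((F' t a - F t a') + (F' t b - F t b')) := by abel
    rw [e]
    refine (norm_sub_le_of_le (norm_add_le_of_le k3.le k6.le) (norm_add_le_of_le k1.le k2.le)).trans
      (le_of_eq (by ring))
  smul c _ a _ := by
    refine tendsto_zero_of_forall_eventually_le
      (4 + 1 + ((2 * (‖a‖ + 1)) + ‖c‖ * 4)) fun r hr hr1 => ?_
    have hopen : IsOpen {p : ℂ × A | ‖c - p.1‖ < r ∧ ‖a - p.2‖ < r ∧ ‖c • a - p.1 • p.2‖ < r} :=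
      IsOpen.and (isOpen_lt (by fun_prop) continuous_const) (IsOpen.and
        (isOpen_lt (by fun_prop) continuous_const) (isOpen_lt (by fun_prop) continuous_const))
    obtain ⟨⟨c', a'⟩, ⟨h1, h2, h3⟩, hc', ha'⟩ :=
      (hdC.prod hdA).inter_open_nonempty _ hopen ⟨(c, a), by simp [hr]⟩
    simp only at h1 h2 h3 hc' ha'
    have hna : ‖a'‖ < ‖a‖ + 1 := by
      have := norm_sub_norm_le a' a
      rw [norm_sub_rev] at this
      linarith
    filter_upwards [happrox _ a' ha' r h2,
      happrox _ _ (hA₀.smul_mem c' hc' a' ha') r h3, hF.eventually_norm_lt hA₀ ha' hna,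
      eventually_norm_lt_of_tendsto_zero (hF.smul c' hc' a' ha') hr] with t k1 k3 k4 k6
    have e : F' t (c • a) - c • F' t a = (F' t (c • a) - F t (c' • a'))
        + (F t (c' • a') - c' • F t a')
        - ((c - c') • F t a' + c • (F' t a - F t a')) := by
      rw [sub_smul, smul_sub]
      abel
    have n1 : ‖(c - c') • F t a'‖ ≤ r * (2 * (‖a‖ + 1)) := by
      rw [norm_smul]
      gcongr
    have n2 : ‖c • (F' t a - F t a')‖ ≤ ‖c‖ * (4 * r) := by
      rw [norm_smul]
      gcongr
    rw [e]
    refine (norm_sub_le_of_le (norm_add_le_of_le k3.le k6.le) (norm_add_le_of_le n1 n2)).trans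
      (le_of_eq (by ring))
  map_star a _ := by
    refine tendsto_zero_of_forall_eventually_le (4 + 1 + 4) fun r hr hr1 => ?_
    obtain ⟨a', ha', h1⟩ := hdA.exists_dist_lt a hr
    rw [dist_eq_norm] at h1
    filter_upwards [happrox _ a' ha' r h1,
      happrox _ _ (hA₀.star_mem a' ha') r (by rwa [← star_sub, norm_star]),
      eventually_norm_lt_of_tendsto_zero (hF.map_star a' ha') hr] with t k1 k3 k6
    have e : F' t (star a) - star (F' t a) = (F' t (star a) - F t (star a'))
        + (F t (star a') - star (F t a')) - star (F' t a - F t a') := by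
      rw [star_sub]
      abel
    rw [e]
    refine (norm_sub_le_of_le (norm_add_le_of_le k3.le k6.le)
      (norm_star (F' t a - F t a') ▸ k1.le)).trans (le_of_eq (by ring))

theorem LiftsAsymp.of_dense (hρ : Continuous ρ) (hJ : ApproxIdeal J) {T : A → M}
    (hT : RepMod J T) {A₀ : Set A} {C₀ : Set ℂ} (hA₀ : AdmissibleSet A₀ C₀) (hdA : Dense A₀)
    (hdC : Dense C₀) {F : ι → A → M} (hFc : ∀ a ∈ A₀, Continuous fun t => F t a)
    (hF : AsympHomOn (comap ρ atTop) A₀ C₀ F) (hFT : ∀ t, ∀ a ∈ A₀, F t a - T a ∈ J) :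
    LiftsAsymp ρ J T := by
  have key : ∀ a, ∃ k : ι → M, Continuous k ∧ (∀ t, k t - T a ∈ J) ∧
      ∀ a' ∈ A₀, ∀ r, ‖a - a'‖ < r → ∀ᶠ t in comap ρ atTop, ‖k t - F t a'‖ < 4 * r := by
    intro a
    have : ∀ n : ℕ, ∃ a' ∈ A₀, ‖a - a'‖ < 1 / (n + 1) := fun n => by
      simpa [dist_eq_norm] using hdA.exists_dist_lt a (ε := 1 / ((n : ℝ) + 1)) (by positivity)
    choose s hs hsa using this
    obtain ⟨k, hk, hkT, hkF⟩ := exists_continuous_correction (J := J) hρ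
      (h := fun _ => T a) continuous_const (g := fun n t => F t (s n)) (fun n => hFc _ (hs n))
      (ε := fun n => 8 * (1 / (n + 1))) (by
        intro N
        obtain ⟨c, hc, hcn⟩ := hT.exists_norm_sub_add_lt hJ (hsa N)
        have hev : ∀ᶠ t in comap ρ atTop, ∀ n ∈ Finset.range (N + 1),
            ‖F t (s N) - F t (s n)‖ < 3 * (2 * (1 / (n + 1))) := by
          refine (Filter.eventually_all_finset _).mpr fun n hn => ?_
          refine hF.eventually_norm_sub_lt hA₀ (hs N) (hs n) ?_
          have h1 : (1 : ℝ) / (N + 1) ≤ 1 / (n + 1) :=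
            Nat.one_div_le_one_div (Finset.mem_range_succ_iff.mp hn)
          have h2 := norm_sub_le_norm_sub_add_norm_sub (s N) a (s n)
          rw [norm_sub_rev (s N) a] at h2
          linarith [hsa N, hsa n]
        filter_upwards [hev] with t ht
        refine ⟨F t (s N) - T (s N) + c, J.add_mem (hFT _ _ (hs N)) hc, fun n hn => ?_⟩
        have h1 : (1 : ℝ) / (N + 1) ≤ 1 / (n + 1) := Nat.one_div_le_one_div hn
        have h2 := ht n (Finset.mem_range_succ_iff.mpr hn)
        have e : T a + (F t (s N) - T (s N) + c) - F t (s n)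
            = (T a - T (s N) + c) + (F t (s N) - F t (s n)) := by abel
        rw [e]
        linarith [norm_add_le (T a - T (s N) + c) (F t (s N) - F t (s n))])
    refine ⟨k, hk, hkT, fun a' ha' r har => ?_⟩
    obtain ⟨n, hn⟩ := exists_nat_one_div_lt (show 0 < (r - ‖a - a'‖) / 8 by linarith)
    have hr : ‖s n - a'‖ < r := by
      have h2 := norm_sub_le_norm_sub_add_norm_sub (s n) a a'
      rw [norm_sub_rev (s n) a] at h2
      linarith [hsa n, norm_nonneg (a - a')]
    filter_upwards [hkF n, hF.eventually_norm_sub_lt hA₀ (hs n) ha' hr] with t h1 h2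
    have h3 := norm_sub_le_norm_sub_add_norm_sub (k t) (F t (s n)) (F t a')
    linarith [norm_nonneg (a - a')]
  choose k hk hkT hkF using key
  exact ⟨fun t a => k a t, hk, hF.extend_of_approx hA₀ hdA hdC hkF, fun t a => hkT a t⟩

end Selection

section HomotopyInvariance

/-- One step of closing a subset of a C⋆-algebra under the operations in `AdmissibleSet`. -/
def admissibleStep {A : Type*} [NonUnitalCStarAlgebra A] (C₀ : Set ℂ) (D : A → A) (S : Set A) :
    Set A :=
  S ∪ (Set.image2 (· * ·) S S ∪ (Set.image2 (· + ·) S S ∪ (star '' S ∪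
    (Set.image2 (· • ·) C₀ S ∪ D '' S))))

theorem exists_countable_admissibleSet (A : Type*) [NonUnitalCStarAlgebra A]
    [TopologicalSpace.SeparableSpace A] :
    ∃ (A₀ : Set A) (C₀ : Set ℂ), A₀.Countable ∧ C₀.Countable ∧ Dense A₀ ∧ Dense C₀ ∧
      AdmissibleSet A₀ C₀ := by
  obtain ⟨S, hSc, hSd⟩ := TopologicalSpace.exists_countable_dense A
  obtain ⟨C, hCc, hCd⟩ := TopologicalSpace.exists_countable_dense ℂ
  set C₀ : Set ℂ := C ∪ Set.range (fun q : ℚ => (q : ℂ))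
  have hC₀ : C₀.Countable := hCc.union (Set.countable_range _)
  have hD : ∀ a : A, ∃ d : A, ‖a‖ < 1 → star d = d ∧ star a * a + d * d = d + d := by
    intro a
    by_cases ha : ‖a‖ < 1
    · obtain ⟨d, hd⟩ := exists_defect ha
      exact ⟨d, fun _ => hd⟩
    · exact ⟨0, fun h => (ha h).elim⟩
  choose D hD using hD
  set G : ℕ → Set A := fun n => (admissibleStep C₀ D)^[n] S
  have hGs : ∀ n, G (n + 1) = admissibleStep C₀ D (G n) := fun n =>
    Function.iterate_succ_apply' _ _ _
  have hmono : Monotone G := monotone_nat_of_le_succ fun n => by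
    rw [hGs]
    exact Set.subset_union_left
  have hcount : ∀ n, (G n).Countable := by
    intro n
    induction n with
    | zero => exact hSc
    | succ n ih =>
      rw [hGs]
      exact ih.union ((ih.image2 ih _).union ((ih.image2 ih _).union ((ih.image _).union
        ((hC₀.image2 ih _).union (ih.image _)))))
  have hstep : ∀ n, admissibleStep C₀ D (G n) ⊆ ⋃ n, G n := fun n => by
    rw [← hGs]
    exact Set.subset_iUnion G _
  refine ⟨⋃ n, G n, C₀, Set.countable_iUnion hcount, hC₀,
    hSd.mono (Set.subset_iUnion G 0), hCd.mono Set.subset_union_left, ?_, ?_, ?_, ?_, ?_, ?_⟩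
  · intro a ha b hb
    obtain ⟨n, hn⟩ := Set.mem_iUnion.mp ha
    obtain ⟨m, hm⟩ := Set.mem_iUnion.mp hb
    exact hstep (max n m) (Or.inr (Or.inl (Set.mem_image2_of_mem (hmono (le_max_left _ _) hn)
      (hmono (le_max_right _ _) hm))))
  · intro a ha b hb
    obtain ⟨n, hn⟩ := Set.mem_iUnion.mp ha
    obtain ⟨m, hm⟩ := Set.mem_iUnion.mp hb
    exact hstep (max n m) (Or.inr (Or.inr (Or.inl (Set.mem_image2_of_mem
      (hmono (le_max_left _ _) hn) (hmono (le_max_right _ _) hm)))))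
  · intro a ha
    obtain ⟨n, hn⟩ := Set.mem_iUnion.mp ha
    exact hstep n (Or.inr (Or.inr (Or.inr (Or.inl (Set.mem_image_of_mem _ hn)))))
  · intro c hc a ha
    obtain ⟨n, hn⟩ := Set.mem_iUnion.mp ha
    exact hstep n (Or.inr (Or.inr (Or.inr (Or.inr (Or.inl (Set.mem_image2_of_mem hc hn))))))
  · intro a ha ha1
    obtain ⟨n, hn⟩ := Set.mem_iUnion.mp ha
    exact ⟨D a, hstep n (Or.inr (Or.inr (Or.inr (Or.inr (Or.inr (Set.mem_image_of_mem _ hn)))))),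
      hD a ha1⟩
  · exact fun q => Or.inr ⟨q, rfl⟩

theorem tendsto_chainEval_sub_zero_mul {M ι : Type*} [CStarAlgebra M] {ρ : ι → ℝ} {u : ℕ → M} {θ : C(unitInterval, M)}
    (hθ : AsympCommutes u θ) (hρ0 : ∀ t, 0 ≤ ρ t) {β : ι → M} {C : ℝ}
    (hC : ∀ᶠ t in comap ρ atTop, ‖β t‖ ≤ C)
    (hβ : ∃ j : ℕ, ∀ i : ℕ, j ≤ i → ∀ t, ρ t ≤ i + 1 →
      ‖(1 - u i) * β t‖ ≤ (1 / 4 : ℝ) ^ i ∧ ‖β t * (1 - u i)‖ ≤ (1 / 4 : ℝ) ^ i) :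
    Tendsto (fun t => (chainEval u (ρ t) θ - θ 0) * β t) (comap ρ atTop) (𝓝 0) ∧
      Tendsto (fun t => β t * (chainEval u (ρ t) θ - θ 0)) (comap ρ atTop) (𝓝 0) := by
  obtain ⟨j₁, hj₁⟩ := hθ
  obtain ⟨j₂, hj₂⟩ := hβ
  have hlim := (tendsto_chainRate_floor (2 * (‖θ‖ + C))).comp (tendsto_comap (f := ρ) (x := atTop))
  have hev : ∀ᶠ t in comap ρ atTop, ((max j₁ j₂ : ℕ) : ℝ) ≤ ρ t :=
    eventually_comap_atTop_iff.mpr ⟨_, fun t ht => ht⟩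
  have key : ∀ᶠ t in comap ρ atTop,
      ‖(chainEval u (ρ t) θ - θ 0) * β t‖ ≤ 2 * (‖θ‖ + C) * chainRate ⌊ρ t⌋₊ ∧
      ‖β t * (chainEval u (ρ t) θ - θ 0)‖ ≤ 2 * (‖θ‖ + C) * chainRate ⌊ρ t⌋₊ := by
    filter_upwards [hC, hev] with t h1 h2
    obtain ⟨k1, k2⟩ := norm_chainEval_sub_zero_mul_le (u := u) (θ := θ) (j := max j₁ j₂)
      (fun i hi s => hj₁ i ((le_max_left _ _).trans hi) s) (hρ0 t) h2 (b := β t)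
      (fun i hi hri => hj₂ i ((le_max_right _ _).trans hi) t hri)
    have hr := chainRate_nonneg ⌊ρ t⌋₊
    have hle : 2 * (‖θ‖ + ‖β t‖) * chainRate ⌊ρ t⌋₊ ≤ 2 * (‖θ‖ + C) * chainRate ⌊ρ t⌋₊ := by
      gcongr
    exact ⟨k1.trans hle, k2.trans hle⟩
  exact ⟨squeeze_zero_norm' (key.mono fun t h => h.1) hlim,
    squeeze_zero_norm' (key.mono fun t h => h.2) hlim⟩

variable {A M ι : Type*} [NonUnitalCStarAlgebra A] [CStarAlgebra M] [TopologicalSpace ι]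
  {ρ : ι → ℝ} {J : Submodule ℂ M} [PartialOrder M] [StarOrderedRing M]

theorem ApproxIdeal.exists_adapted_unit (hJ : ApproxIdeal J) {a : ℕ → C(unitInterval, M)}
    {d : ℕ → C(unitInterval, M)} (hd : ∀ n s, d n s ∈ J) {β : ℕ → ι → M}
    (hβc : ∀ n, Continuous (β n)) (hβ : ∀ n t, β n t ∈ J) (hcpt : ∀ R, IsCompact {t | ρ t ≤ R}) :
    ∃ u : ℕ → M, (∀ i, u i ∈ J ∧ 0 ≤ u i ∧ ‖u i‖ < 1) ∧ (∀ i j, i < j → u i ≤ u j) ∧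
      (∀ i j, i < j → ‖(1 - u j) * u i‖ ≤ (1 / 4 : ℝ) ^ j) ∧
      (∀ n i, n ≤ i → ∀ s, ‖u i * a n s - a n s * u i‖ ≤ (1 / 4 : ℝ) ^ i) ∧
      (∀ n i, n ≤ i → ∀ s, ‖(1 - u i) * d n s‖ ≤ (1 / 4 : ℝ) ^ i) ∧
      (∀ n i : ℕ, n ≤ i → ∀ t, ρ t ≤ i + 1 → ‖(1 - u i) * β n t‖ ≤ (1 / 4 : ℝ) ^ i ∧
        ‖β n t * (1 - u i)‖ ≤ (1 / 4 : ℝ) ^ i) := by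
  let K₁ : ℕ → Set M := fun i => ⋃ n ∈ Finset.range (i + 1), Set.range (a n)
  let K₂ : ℕ → Set M := fun i => ⋃ n ∈ Finset.range (i + 1),
    (Set.range (d n) ∪ β n '' {t | ρ t ≤ i + 1})
  have hK₁ : ∀ i, IsCompact (K₁ i) := fun i =>
    (Finset.range (i + 1)).isCompact_biUnion fun n _ => isCompact_range (a n).continuous
  have hK₂ : ∀ i, IsCompact (K₂ i) := fun i =>
    (Finset.range (i + 1)).isCompact_biUnion fun n _ => (isCompact_range (d n).continuous).union
      ((hcpt _).image (hβc n))
  have hK₁m : Monotone K₁ := fun i j hij => Set.biUnion_subset_biUnion_left fun n hn => by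
    simp only [Finset.coe_range, Set.mem_Iio] at hn ⊢
    omega
  have hK₂m : Monotone K₂ := fun i j hij => by
    have hc : (i : ℝ) ≤ j := by exact_mod_cast hij
    refine Set.iUnion₂_subset fun n hn => ?_
    refine Set.Subset.trans ?_ (Set.subset_biUnion_of_mem (u := fun n =>
      (Set.range (d n) ∪ β n '' {t | ρ t ≤ j + 1})) (show n ∈ Finset.range (j + 1) by
        rw [Finset.mem_range] at hn ⊢
        omega))
    exact Set.union_subset_union_right _ (Set.image_mono fun t (ht : ρ t ≤ i + 1) =>
      show ρ t ≤ j + 1 by linarith)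
  have hK₂J : ∀ i, ∀ x ∈ K₂ i, x ∈ J := by
    intro i x hx
    simp only [K₂, Set.mem_iUnion] at hx
    obtain ⟨n, _, ⟨s, rfl⟩ | ⟨t, _, rfl⟩⟩ := hx
    exacts [hd n s, hβ n t]
  obtain ⟨u, h1, h2, h3, h4, h5⟩ := hJ.exists_quasicentral_seq hK₁ hK₂ hK₂J hK₁m hK₂m
  have mem₁ : ∀ n i, n ≤ i → ∀ s, a n s ∈ K₁ i := fun n i hni s =>
    Set.mem_biUnion (by simpa [Nat.lt_succ_iff] using hni) (Set.mem_range_self s)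
  have mem₂ : ∀ n i, n ≤ i → ∀ s, d n s ∈ K₂ i := fun n i hni s =>
    Set.mem_biUnion (by simpa [Nat.lt_succ_iff] using hni) (Or.inl (Set.mem_range_self s))
  have mem₃ : ∀ n i : ℕ, n ≤ i → ∀ t, ρ t ≤ i + 1 → β n t ∈ K₂ i := fun n i hni t ht =>
    Set.mem_biUnion (by simpa [Nat.lt_succ_iff] using hni) (Or.inr ⟨t, ht, rfl⟩)
  exact ⟨u, h1, h2, h3, fun n i hni s => h4 i _ (mem₁ n i hni s),
    fun n i hni s => (h5 i _ (mem₂ n i hni s)).1, fun n i hni t ht => h5 i _ (mem₃ n i hni t ht)⟩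

theorem LiftsAsymp.of_homotopy [NormalSpace ι] [ParacompactSpace ι] [TopologicalSpace.SeparableSpace A] (hρ : Continuous ρ)
    (hρ0 : ∀ t, 0 ≤ ρ t) (hcpt : ∀ R, IsCompact {t | ρ t ≤ R}) (hJ : ApproxIdeal J)
    {T₀ T₁ : A → M} (hT₁ : RepMod J T₁) {Θ : A → C(unitInterval, M)}
    (hmul : ∀ a b s, (Θ (a * b) - Θ a * Θ b) s ∈ J)
    (hadd : ∀ a b s, (Θ (a + b) - (Θ a + Θ b)) s ∈ J)
    (hsmul : ∀ (c : ℂ) a s, (Θ (c • a) - c • Θ a) s ∈ J)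
    (hstar : ∀ a s, (Θ (star a) - star (Θ a)) s ∈ J)
    (h0 : ∀ a, Θ a 0 - T₀ a ∈ J) (h1 : ∀ a, Θ a 1 - T₁ a ∈ J)
    (hL : LiftsAsymp ρ J T₀) : LiftsAsymp ρ J T₁ := by
  obtain ⟨Φ, hΦc, hΦ, hΦT⟩ := hL
  obtain ⟨A₀, C₀, hAc, hCc, hdA, hdC, hA₀⟩ := exists_countable_admissibleSet A
  let D : Set C(unitInterval, M) := Set.image2 (fun a b => Θ (a * b) - Θ a * Θ b) A₀ A₀ ∪
    (Set.image2 (fun a b => Θ (a + b) - (Θ a + Θ b)) A₀ A₀ ∪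
    (Set.image2 (fun (c : ℂ) a => Θ (c • a) - c • Θ a) C₀ A₀ ∪
    (fun a => Θ (star a) - star (Θ a)) '' A₀))
  have hDc : D.Countable := (hAc.image2 hAc _).union ((hAc.image2 hAc _).union
    ((hCc.image2 hAc _).union (hAc.image _)))
  have hDJ : ∀ δ ∈ D, ∀ s, δ s ∈ J := by
    rintro δ (⟨a, _, b, _, rfl⟩ | ⟨a, _, b, _, rfl⟩ | ⟨c, _, a, _, rfl⟩ | ⟨a, _, rfl⟩) s
    exacts [hmul a b s, hadd a b s, hsmul c a s, hstar a s]
  obtain ⟨a₀, ha₀⟩ : A₀.Nonempty := hdA.nonempty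
  obtain ⟨e, he⟩ := hAc.exists_eq_range ⟨a₀, ha₀⟩
  obtain ⟨d, hd⟩ := hDc.exists_eq_range ⟨_, Or.inl (Set.mem_image2_of_mem ha₀ ha₀)⟩
  have hβJ : ∀ a t, Φ t a - Θ a 0 ∈ J := fun a t => by
    have := J.sub_mem (hΦT t a) (h0 a)
    rwa [sub_sub_sub_cancel_right] at this
  obtain ⟨u, hu, humono, huorth, hua, hud, huβ⟩ := hJ.exists_adapted_unit (ρ := ρ)
    (a := fun n => Θ (e n)) (d := d) (fun n s => hDJ _ (hd ▸ Set.mem_range_self n) s)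
    (β := fun n t => Φ t (e n) - Θ (e n) 0) (fun n => (hΦc _).sub continuous_const)
    (fun n t => hβJ _ t) hcpt
  have hcomm : ∀ a ∈ A₀, AsympCommutes u (Θ a) := by
    intro a ha
    rw [he] at ha
    obtain ⟨n, rfl⟩ := ha
    exact ⟨n, hua n⟩
  have hlim := tendsto_comap (f := ρ) (x := atTop)
  have hδ : ∀ δ ∈ D, Tendsto (fun t => chainEval u (ρ t) δ - δ 0) (comap ρ atTop) (𝓝 0) := by
    intro δ hδ
    rw [hd] at hδ
    obtain ⟨n, rfl⟩ := hδ
    exact (tendsto_chainEval_sub_zero ⟨n, hud n⟩).comp hlim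
  have hcross : ∀ a ∈ A₀, ∀ b ∈ A₀,
      Tendsto (fun t => (chainEval u (ρ t) (Θ a) - Θ a 0) * (Φ t b - Θ b 0))
        (comap ρ atTop) (𝓝 0) ∧
      Tendsto (fun t => (Φ t b - Θ b 0) * (chainEval u (ρ t) (Θ a) - Θ a 0))
        (comap ρ atTop) (𝓝 0) := by
    intro a ha b hb
    refine tendsto_chainEval_sub_zero_mul (hcomm a ha) hρ0 (C := 2 * (‖b‖ + 1) + ‖Θ b 0‖) ?_ ?_
    · filter_upwards [hΦ.eventually_norm_lt admissibleSet_univ (Set.mem_univ b)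
        (lt_add_one ‖b‖)] with t ht
      exact (norm_sub_le _ _).trans (by linarith)
    · rw [he] at hb
      obtain ⟨n, rfl⟩ := hb
      exact ⟨n, huβ n⟩
  have hu1 : ∀ i, u i ≤ 1 := fun i => le_one_of_norm_lt (hu i).2.1 (hu i).2.2
  refine LiftsAsymp.of_dense (F := fun t a => chainEval u (ρ t) (Θ a) + (Φ t a - Θ a 0)) hρ hJ hT₁
    hA₀ hdA hdC (fun a _ => (continuous_chainEval u hρ hρ0 _).add ((hΦc a).sub continuous_const))
    ⟨?_, ?_, ?_, ?_⟩ ?_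
  · intro a ha b hb
    have k1 := hδ _ (Or.inl (Set.mem_image2_of_mem ha hb))
    have k2 := (tendsto_chainEval_mul (fun i => (hu i).2.1) hu1 humono huorth (hcomm a ha)
      (hcomm b hb)).comp hlim
    have k := ((((k1.sub k2).sub (hcross a ha b hb).1).sub (hcross b hb a ha).2).add
      (hΦ.mul a trivial b trivial))
    simp only [sub_zero, add_zero] at k
    refine k.congr fun t => ?_
    simp only [Function.comp, chainEval_sub, ContinuousMap.sub_apply, ContinuousMap.mul_apply]
    noncomm_ring
  · intro a ha b hb
    have k1 := hδ _ (Or.inr (Or.inl (Set.mem_image2_of_mem ha hb)))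
    have k := k1.add (hΦ.add a trivial b trivial)
    simp only [add_zero] at k
    refine k.congr fun t => ?_
    simp only [chainEval_sub, chainEval_add, ContinuousMap.sub_apply, ContinuousMap.add_apply]
    abel
  · intro c hc a ha
    have k1 := hδ _ (Or.inr (Or.inr (Or.inl (Set.mem_image2_of_mem hc ha))))
    have k := k1.add (hΦ.smul c trivial a trivial)
    simp only [add_zero] at k
    refine k.congr fun t => ?_
    simp only [chainEval_sub, chainEval_smul, ContinuousMap.sub_apply, ContinuousMap.smul_apply,
      smul_add, smul_sub]
    abel
  · intro a ha
    have k1 := hδ _ (Or.inr (Or.inr (Or.inr (Set.mem_image_of_mem _ ha))))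
    have k2 := (tendsto_star_chainEval (fun i => (IsSelfAdjoint.of_nonneg (hu i).2.1).star_eq)
      (hcomm a ha)).comp hlim
    have k := (k1.sub k2).add (hΦ.map_star a trivial)
    simp only [add_zero, sub_zero] at k
    refine k.congr fun t => ?_
    simp only [Function.comp, chainEval_sub, ContinuousMap.sub_apply, ContinuousMap.star_apply,
      star_add, star_sub]
    abel
  · intro t a _
    have k1 := chainEval_sub_mem (J := J) (fun i m => hJ.mul_right m (hu i).1) (hρ0 t) (Θ a)
    have k := J.add_mem (J.add_mem k1 (h1 a)) (hβJ a t)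
    convert k using 1
    abel

end HomotopyInvariance

section Relations

/-- The pair `S₁, S₂` are the canonical generators of a unital copy of the Cuntz algebra `𝒪₂`. -/
structure IsCuntzPair {M : Type*} [CStarAlgebra M] (S₁ S₂ : M) : Prop where
  star_mul_self_left : star S₁ * S₁ = 1
  star_mul_self_right : star S₂ * S₂ = 1
  add_eq_one : S₁ * star S₁ + S₂ * star S₂ = 1

/-- The direct sum of two maps, formed with the help of two isometries. -/
def isometrySum {A M : Type*} [CStarAlgebra M] (S₁ S₂ : M) (P Q : A → M) : A → M :=
  fun a => S₁ * P a * star S₁ + S₂ * Q a * star S₂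

/-- Unitary equivalence modulo `J`. -/
def UnitaryEquivMod {A M : Type*} [CStarAlgebra M] (J : Submodule ℂ M) (P Q : A → M) : Prop :=
  ∃ U : M, star U * U = 1 ∧ U * star U = 1 ∧ ∀ a, star U * P a * U - Q a ∈ J

/-- Continuous approximate unitary equivalence modulo `J`. -/
def ContApproxEquivMod {A M : Type*} [CStarAlgebra M] (J : Submodule ℂ M) (P Q : A → M) : Prop :=
  ∃ U : NNReal → M, Continuous U ∧ (∀ t, star (U t) * U t = 1 ∧ U t * star (U t) = 1) ∧
    ∀ a, ∀ ε > 0, ∀ᶠ t in atTop, ∃ b ∈ J, ‖star (U t) * P a * U t - Q a + b‖ < ε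

/-- Homotopy modulo `J`. -/
def HomotopyMod {A M : Type*} [NonUnitalCStarAlgebra A] [CStarAlgebra M] (J : Submodule ℂ M)
    (P Q : A → M) : Prop :=
  ∃ Θ : A → C(unitInterval, M),
    (∀ a b, ∀ s, (Θ (a * b) - Θ a * Θ b) s ∈ J) ∧
    (∀ a b, ∀ s, (Θ (a + b) - (Θ a + Θ b)) s ∈ J) ∧
    (∀ (c : ℂ) (a : A), ∀ s, (Θ (c • a) - c • Θ a) s ∈ J) ∧
    (∀ a, ∀ s, (Θ (star a) - star (Θ a)) s ∈ J) ∧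
    (∀ a, Θ a 0 - P a ∈ J) ∧
    (∀ a, Θ a 1 - Q a ∈ J)

variable {A M ι : Type*} [CStarAlgebra M]
  {J : Submodule ℂ M} {S₁ S₂ : M} {P P' Q Q' R : A → M}

theorem mul_star_mul_cancel {S : M} (hS : star S * S = 1) (x : M) : star S * (S * x) = x := by
  rw [← mul_assoc, hS, one_mul]

theorem IsCuntzPair.star_mul_left_right (h : IsCuntzPair S₁ S₂) : star S₁ * S₂ = 0 := by
  have h1 : star S₁ * (S₁ * star S₁ + S₂ * star S₂) * S₂ = star S₁ * S₂ := by
    rw [h.add_eq_one, mul_one]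
  have h2 : star S₁ * (S₁ * star S₁ + S₂ * star S₂) * S₂ = star S₁ * S₂ + star S₁ * S₂ := by
    rw [mul_add, add_mul, mul_star_mul_cancel h.star_mul_self_left, mul_assoc, mul_assoc,
      h.star_mul_self_right, mul_one]
  rw [h1] at h2
  exact left_eq_add.mp h2

theorem IsCuntzPair.star_mul_right_left (h : IsCuntzPair S₁ S₂) : star S₂ * S₁ = 0 := by
  have := congrArg star h.star_mul_left_right
  rwa [star_mul, star_star, star_zero] at this

theorem IsCuntzPair.star_mul_left_right_mul (h : IsCuntzPair S₁ S₂) (x : M) :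
    star S₁ * (S₂ * x) = 0 := by
  rw [← mul_assoc, h.star_mul_left_right, zero_mul]

theorem IsCuntzPair.star_mul_right_left_mul (h : IsCuntzPair S₁ S₂) (x : M) :
    star S₂ * (S₁ * x) = 0 := by
  rw [← mul_assoc, h.star_mul_right_left, zero_mul]

theorem IsCuntzPair.sandwich_add_sandwich (h : IsCuntzPair S₁ S₂) :
    S₁ * (S₁ * (star S₁ * star S₁)) + S₁ * (S₂ * (star S₂ * star S₁)) = S₁ * star S₁ := by
  rw [← mul_add, ← mul_assoc S₁, ← mul_assoc S₂, ← add_mul, h.add_eq_one, one_mul]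

theorem IsCuntzPair.sandwich_add_sandwich' (h : IsCuntzPair S₁ S₂) :
    S₂ * (S₁ * (star S₁ * star S₂)) + S₂ * (S₂ * (star S₂ * star S₂)) = S₂ * star S₂ := by
  rw [← mul_add, ← mul_assoc S₁, ← mul_assoc S₂ (star S₂), ← add_mul, h.add_eq_one, one_mul]

namespace UnitaryEquivMod

theorem of_sub_mem (h : ∀ a, P a - Q a ∈ J) : UnitaryEquivMod J P Q :=
  ⟨1, by simp, by simp, by simpa using h⟩

theorem refl (J : Submodule ℂ M) (P : A → M) : UnitaryEquivMod J P P :=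
  of_sub_mem fun a => by simp

theorem symm [PartialOrder M] (hJ : ApproxIdeal J) (h : UnitaryEquivMod J P Q) : UnitaryEquivMod J Q P := by
  obtain ⟨U, h1, h2, h3⟩ := h
  refine ⟨star U, by rwa [star_star], by rwa [star_star], fun a => ?_⟩
  have := hJ.mul_right (star U) (hJ.mul_left U (J.neg_mem (h3 a)))
  convert this using 1
  simp only [star_star, neg_sub, mul_sub, sub_mul, ← mul_assoc, h2, one_mul]
  rw [mul_assoc _ U, h2, mul_one]

theorem trans [PartialOrder M] (hJ : ApproxIdeal J) (h : UnitaryEquivMod J P Q) (h' : UnitaryEquivMod J Q R) :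
    UnitaryEquivMod J P R := by
  obtain ⟨U, h1, h2, h3⟩ := h
  obtain ⟨V, k1, k2, k3⟩ := h'
  refine ⟨U * V, ?_, ?_, fun a => ?_⟩
  · rw [star_mul, mul_assoc, mul_star_mul_cancel h1, k1]
  · rw [star_mul, mul_assoc, ← mul_assoc V, k2, one_mul, h2]
  · have := J.add_mem (hJ.mul_right V (hJ.mul_left (star V) (h3 a))) (k3 a)
    convert this using 1
    simp only [star_mul]
    noncomm_ring

theorem sum [PartialOrder M] (hJ : ApproxIdeal J) (hS : IsCuntzPair S₁ S₂) (h : UnitaryEquivMod J P P')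
    (h' : UnitaryEquivMod J Q Q') :
    UnitaryEquivMod J (isometrySum S₁ S₂ P Q) (isometrySum S₁ S₂ P' Q') := by
  obtain ⟨U, h1, h2, h3⟩ := h
  obtain ⟨V, k1, k2, k3⟩ := h'
  refine ⟨S₁ * U * star S₁ + S₂ * V * star S₂, ?_, ?_, fun a => ?_⟩
  · simp only [star_add, star_mul, star_star, mul_add, add_mul, mul_assoc,
      mul_star_mul_cancel hS.star_mul_self_left, mul_star_mul_cancel hS.star_mul_self_right,
      hS.star_mul_left_right_mul, hS.star_mul_right_left_mul, mul_zero, add_zero, zero_add,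
      mul_star_mul_cancel h1, mul_star_mul_cancel k1, hS.add_eq_one]
  · have h2' : ∀ x, U * (star U * x) = x := fun x => by rw [← mul_assoc, h2, one_mul]
    have k2' : ∀ x, V * (star V * x) = x := fun x => by rw [← mul_assoc, k2, one_mul]
    simp only [star_add, star_mul, star_star, mul_add, add_mul, mul_assoc,
      mul_star_mul_cancel hS.star_mul_self_left, mul_star_mul_cancel hS.star_mul_self_right,
      hS.star_mul_left_right_mul, hS.star_mul_right_left_mul, mul_zero, add_zero, zero_add,
      h2', k2', hS.add_eq_one]
  · have := J.add_mem (hJ.mul_right (star S₁) (hJ.mul_left S₁ (h3 a)))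
      (hJ.mul_right (star S₂) (hJ.mul_left S₂ (k3 a)))
    convert this using 1
    simp only [isometrySum, star_add, star_mul, star_star, mul_add, add_mul, mul_assoc,
      mul_star_mul_cancel hS.star_mul_self_left, mul_star_mul_cancel hS.star_mul_self_right,
      hS.star_mul_left_right_mul, hS.star_mul_right_left_mul, mul_zero, add_zero, zero_add,
      mul_sub, sub_mul]
    abel

theorem sum_comm (J : Submodule ℂ M) (hS : IsCuntzPair S₁ S₂) (P Q : A → M) :
    UnitaryEquivMod J (isometrySum S₁ S₂ P Q) (isometrySum S₁ S₂ Q P) := by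
  refine ⟨S₁ * star S₂ + S₂ * star S₁, ?_, ?_, fun a => ?_⟩
  · simp only [star_add, star_mul, star_star, mul_add, add_mul, mul_assoc,
      mul_star_mul_cancel hS.star_mul_self_left, mul_star_mul_cancel hS.star_mul_self_right,
      hS.star_mul_left_right_mul, hS.star_mul_right_left_mul, mul_zero, add_zero, zero_add]
    rw [add_comm, hS.add_eq_one]
  · simp only [star_add, star_mul, star_star, mul_add, add_mul, mul_assoc,
      mul_star_mul_cancel hS.star_mul_self_left, mul_star_mul_cancel hS.star_mul_self_right,
      hS.star_mul_left_right_mul, hS.star_mul_right_left_mul, mul_zero, add_zero, zero_add]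
    rw [hS.add_eq_one]
  · convert J.zero_mem using 1
    simp only [isometrySum, star_add, star_mul, star_star, mul_add, add_mul, mul_assoc,
      mul_star_mul_cancel hS.star_mul_self_left, mul_star_mul_cancel hS.star_mul_self_right,
      hS.star_mul_left_right_mul, hS.star_mul_right_left_mul, mul_zero, add_zero, zero_add]
    abel

theorem sum_assoc (J : Submodule ℂ M) (hS : IsCuntzPair S₁ S₂) (P Q R : A → M) :
    UnitaryEquivMod J (isometrySum S₁ S₂ (isometrySum S₁ S₂ P Q) R)
      (isometrySum S₁ S₂ P (isometrySum S₁ S₂ Q R)) := by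
  refine ⟨S₁ * S₁ * star S₁ + S₁ * S₂ * star S₁ * star S₂ + S₂ * star S₂ * star S₂,
    ?_, ?_, fun a => ?_⟩
  · simp only [star_add, star_mul, star_star, mul_add, add_mul, mul_assoc,
      mul_star_mul_cancel hS.star_mul_self_left, mul_star_mul_cancel hS.star_mul_self_right,
      hS.star_mul_left_right_mul, hS.star_mul_right_left_mul, mul_zero, add_zero, zero_add]
    rw [add_assoc, hS.sandwich_add_sandwich', hS.add_eq_one]
  · simp only [star_add, star_mul, star_star, mul_add, add_mul, mul_assoc,
      mul_star_mul_cancel hS.star_mul_self_left, mul_star_mul_cancel hS.star_mul_self_right,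
      hS.star_mul_left_right_mul, hS.star_mul_right_left_mul, mul_zero, add_zero, zero_add]
    rw [hS.sandwich_add_sandwich, hS.add_eq_one]
  · convert J.zero_mem using 1
    simp only [isometrySum, star_add, star_mul, star_star, mul_add, add_mul, mul_assoc,
      mul_star_mul_cancel hS.star_mul_self_left, mul_star_mul_cancel hS.star_mul_self_right,
      hS.star_mul_left_right_mul, hS.star_mul_right_left_mul, mul_zero, add_zero, zero_add]
    abel

theorem contApprox (h : UnitaryEquivMod J P Q) : ContApproxEquivMod J P Q := by
  obtain ⟨U, h1, h2, h3⟩ := h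
  refine ⟨fun _ => U, continuous_const, fun _ => ⟨h1, h2⟩, fun a ε hε => Eventually.of_forall
    fun t => ⟨-(star U * P a * U - Q a), J.neg_mem (h3 a), ?_⟩⟩
  rw [add_neg_cancel, norm_zero]
  exact hε

end UnitaryEquivMod

/-- Unitary equivalence classes form a commutative semigroup under direct sum. -/
theorem exists_addCommSemigroup_classes.{u, v} (A : Type u) {M : Type v} [CStarAlgebra M]
    [PartialOrder M] {J : Submodule ℂ M} (hJ : ApproxIdeal J) {S₁ S₂ : M}
    (hS : IsCuntzPair S₁ S₂) :
    ∃ (G : Type (max u v)) (_ : AddCommSemigroup G) (c : (A → M) → G),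
      (∀ P Q, c P = c Q ↔ UnitaryEquivMod J P Q) ∧
      ∀ P Q, c (isometrySum S₁ S₂ P Q) = c P + c Q := by
  let s : Setoid (A → M) := ⟨UnitaryEquivMod J, UnitaryEquivMod.refl J,
    UnitaryEquivMod.symm hJ, UnitaryEquivMod.trans hJ⟩
  let add : Quotient s → Quotient s → Quotient s := Quotient.map₂ (isometrySum S₁ S₂)
    fun _ _ h _ _ h' => UnitaryEquivMod.sum hJ hS h h'
  let inst : AddCommSemigroup (Quotient s) :=
    { add := add
      add_assoc := by
        rintro ⟨P⟩ ⟨Q⟩ ⟨R⟩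
        exact Quotient.sound (UnitaryEquivMod.sum_assoc J hS P Q R)
      add_comm := by
        rintro ⟨P⟩ ⟨Q⟩
        exact Quotient.sound (UnitaryEquivMod.sum_comm J hS P Q) }
  refine ⟨Quotient s, inst, Quotient.mk s, fun P Q => ?_, fun P Q => ?_⟩
  · exact Quotient.eq
  · rfl

end Relations

section Stability

variable {A M ι : Type*} [NonUnitalCStarAlgebra A] [CStarAlgebra M]
  {J : Submodule ℂ M} {S₁ S₂ : M} {P Q : A → M}

theorem isometrySum_map_mul_sub (hS : IsCuntzPair S₁ S₂) (P Q : A → M) (a b : A) :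
    isometrySum S₁ S₂ P Q (a * b) - isometrySum S₁ S₂ P Q a * isometrySum S₁ S₂ P Q b
      = S₁ * (P (a * b) - P a * P b) * star S₁ + S₂ * (Q (a * b) - Q a * Q b) * star S₂ := by
  simp only [isometrySum, mul_add, add_mul, mul_assoc, mul_sub, sub_mul,
      mul_star_mul_cancel hS.star_mul_self_left, mul_star_mul_cancel hS.star_mul_self_right,
      hS.star_mul_left_right_mul, hS.star_mul_right_left_mul, mul_zero, add_zero, zero_add]
  abel

theorem isometrySum_map_add_sub (S₁ S₂ : M) (P Q : A → M) (a b : A) :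
    isometrySum S₁ S₂ P Q (a + b) - (isometrySum S₁ S₂ P Q a + isometrySum S₁ S₂ P Q b)
      = S₁ * (P (a + b) - (P a + P b)) * star S₁
        + S₂ * (Q (a + b) - (Q a + Q b)) * star S₂ := by
  simp only [isometrySum]
  noncomm_ring

theorem isometrySum_map_smul_sub (S₁ S₂ : M) (P Q : A → M) (c : ℂ) (a : A) :
    isometrySum S₁ S₂ P Q (c • a) - c • isometrySum S₁ S₂ P Q a
      = S₁ * (P (c • a) - c • P a) * star S₁ + S₂ * (Q (c • a) - c • Q a) * star S₂ := by
  simp only [isometrySum, smul_add, mul_sub, sub_mul, mul_smul_comm, smul_mul_assoc]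
  abel

theorem isometrySum_map_star_sub (S₁ S₂ : M) (P Q : A → M) (a : A) :
    isometrySum S₁ S₂ P Q (star a) - star (isometrySum S₁ S₂ P Q a)
      = S₁ * (P (star a) - star (P a)) * star S₁
        + S₂ * (Q (star a) - star (Q a)) * star S₂ := by
  simp only [isometrySum, star_add, star_mul, star_star, mul_sub, sub_mul, mul_assoc]
  abel

theorem ApproxIdeal.sandwich_mem [PartialOrder M] (hJ : ApproxIdeal J) (S : M) {x : M}
    (hx : x ∈ J) (S' : M) : S * x * S' ∈ J :=
  hJ.mul_right _ (hJ.mul_left _ hx)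

theorem RepMod.isometrySum [PartialOrder M] (hJ : ApproxIdeal J) (hS : IsCuntzPair S₁ S₂)
    (hP : RepMod J P) (hQ : RepMod J Q) : RepMod J (isometrySum S₁ S₂ P Q) where
  mul a b := by
    rw [isometrySum_map_mul_sub hS]
    exact J.add_mem (hJ.sandwich_mem _ (hP.mul a b) _) (hJ.sandwich_mem _ (hQ.mul a b) _)
  add a b := by
    rw [isometrySum_map_add_sub]
    exact J.add_mem (hJ.sandwich_mem _ (hP.add a b) _) (hJ.sandwich_mem _ (hQ.add a b) _)
  smul c a := by
    rw [isometrySum_map_smul_sub]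
    exact J.add_mem (hJ.sandwich_mem _ (hP.smul c a) _) (hJ.sandwich_mem _ (hQ.smul c a) _)
  map_star a := by
    rw [isometrySum_map_star_sub]
    exact J.add_mem (hJ.sandwich_mem _ (hP.map_star a) _) (hJ.sandwich_mem _ (hQ.map_star a) _)

theorem RepMod.zero (J : Submodule ℂ M) : RepMod J (fun _ : A => (0 : M)) where
  mul := by simp
  add := by simp
  smul := by simp
  map_star := by simp

theorem tendsto_sandwich_add_zero {l : Filter ι} {x y : ι → M} (S₁ S₂ : M)
    (hx : Tendsto x l (𝓝 0)) (hy : Tendsto y l (𝓝 0)) :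
    Tendsto (fun t => S₁ * x t * star S₁ + S₂ * y t * star S₂) l (𝓝 0) := by
  have := ((hx.const_mul S₁).mul_const (star S₁)).add ((hy.const_mul S₂).mul_const (star S₂))
  simpa using this

theorem AsympHomOn.isometrySum {l : Filter ι} {A₀ : Set A} {C₀ : Set ℂ} {F G : ι → A → M}
    (hS : IsCuntzPair S₁ S₂) (hF : AsympHomOn l A₀ C₀ F) (hG : AsympHomOn l A₀ C₀ G) :
    AsympHomOn l A₀ C₀ (fun t => isometrySum S₁ S₂ (F t) (G t)) where
  mul a ha b hb := by
    simp only [isometrySum_map_mul_sub hS]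
    exact tendsto_sandwich_add_zero S₁ S₂ (hF.mul a ha b hb) (hG.mul a ha b hb)
  add a ha b hb := by
    simp only [isometrySum_map_add_sub]
    exact tendsto_sandwich_add_zero S₁ S₂ (hF.add a ha b hb) (hG.add a ha b hb)
  smul c hc a ha := by
    simp only [isometrySum_map_smul_sub]
    exact tendsto_sandwich_add_zero S₁ S₂ (hF.smul c hc a ha) (hG.smul c hc a ha)
  map_star a ha := by
    simp only [isometrySum_map_star_sub]
    exact tendsto_sandwich_add_zero S₁ S₂ (hF.map_star a ha) (hG.map_star a ha)

theorem norm_le_one_of_star_mul_self {S : M} (hS : star S * S = 1) : ‖S‖ ≤ 1 := by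
  have h := CStarRing.norm_star_mul_self (x := S)
  rw [hS] at h
  nlinarith [norm_one_le_of_cstar (M := M), norm_nonneg S]

theorem norm_conj_le {U : M} (hU : star U * U = 1) (x : M) : ‖star U * x * U‖ ≤ ‖x‖ := by
  have hU1 := norm_le_one_of_star_mul_self hU
  calc ‖star U * x * U‖ ≤ ‖star U‖ * ‖x‖ * ‖U‖ :=
        (norm_mul_le _ _).trans (by gcongr; exact norm_mul_le _ _)
    _ ≤ 1 * ‖x‖ * 1 := by rw [norm_star]; gcongr
    _ = ‖x‖ := by ring

theorem AsympHomOn.conj {l : Filter ι} {A₀ : Set A} {C₀ : Set ℂ} {F : ι → A → M} {U : ι → M}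
    (hU : ∀ t, star (U t) * U t = 1 ∧ U t * star (U t) = 1) (hF : AsympHomOn l A₀ C₀ F) :
    AsympHomOn l A₀ C₀ (fun t a => star (U t) * F t a * U t) := by
  have hc : ∀ {x : ι → M}, Tendsto x l (𝓝 0) →
      Tendsto (fun t => star (U t) * x t * U t) l (𝓝 0) := fun hx =>
    squeeze_zero_norm (fun t => norm_conj_le (hU t).1 _) (tendsto_zero_iff_norm_tendsto_zero.mp hx)
  constructor
  · intro a ha b hb
    refine (hc (hF.mul a ha b hb)).congr fun t => ?_
    have h2' : ∀ x, U t * (star (U t) * x) = x := fun x => by rw [← mul_assoc, (hU t).2, one_mul]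
    simp only [mul_sub, sub_mul, mul_assoc, h2']
  · intro a ha b hb
    refine (hc (hF.add a ha b hb)).congr fun t => ?_
    noncomm_ring
  · intro c hh a ha
    refine (hc (hF.smul c hh a ha)).congr fun t => ?_
    simp only [mul_sub, sub_mul, mul_smul_comm, smul_mul_assoc]
  · intro a ha
    refine (hc (hF.map_star a ha)).congr fun t => ?_
    simp only [star_mul, star_star, mul_sub, sub_mul, mul_assoc]

variable [TopologicalSpace ι] {ρ : ι → ℝ}

theorem LiftsAsymp.zero (ρ : ι → ℝ) (J : Submodule ℂ M) : LiftsAsymp ρ J (fun _ : A => (0 : M)) :=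
  ⟨fun _ _ => 0, fun _ => continuous_const, ⟨by simp [tendsto_const_nhds], by simp [tendsto_const_nhds],
    by simp [tendsto_const_nhds], by simp [tendsto_const_nhds]⟩, by simp⟩

theorem LiftsAsymp.isometrySum [PartialOrder M] (hJ : ApproxIdeal J) (hS : IsCuntzPair S₁ S₂)
    (hP : LiftsAsymp ρ J P) (hQ : LiftsAsymp ρ J Q) :
    LiftsAsymp ρ J (isometrySum S₁ S₂ P Q) := by
  obtain ⟨F, hFc, hF, hFP⟩ := hP
  obtain ⟨G, hGc, hG, hGQ⟩ := hQ
  refine ⟨_, fun a => ?_, hF.isometrySum hS hG, fun t a => ?_⟩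
  · have := hFc a
    have := hGc a
    unfold _root_.isometrySum
    fun_prop
  · convert J.add_mem (hJ.sandwich_mem S₁ (hFP t a) (star S₁))
      (hJ.sandwich_mem S₂ (hGQ t a) (star S₂)) using 1
    simp only [_root_.isometrySum]
    noncomm_ring

theorem LiftsAsymp.of_approxConj [NormalSpace ι] [ParacompactSpace ι] [PartialOrder M]
    [StarOrderedRing M] (hρ : Continuous ρ) (hJ : ApproxIdeal J) {U : ι → M} (hUc : Continuous U)
    (hU : ∀ t, star (U t) * U t = 1 ∧ U t * star (U t) = 1)
    (hPQ : ∀ a, ∀ ε > 0, ∀ᶠ t in comap ρ atTop, ∃ b ∈ J, ‖star (U t) * P a * U t - Q a + b‖ < ε)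
    (hP : LiftsAsymp ρ J P) : LiftsAsymp ρ J Q := by
  obtain ⟨F, hFc, hF, hFP⟩ := hP
  have hG := hF.conj hU
  have hGc : ∀ a, Continuous fun t => star (U t) * F t a * U t := fun a => by
    have := hFc a
    fun_prop
  have key : ∀ a, ∃ k : ι → M, Continuous k ∧ (∀ t, k t - Q a ∈ J) ∧
      ∀ n : ℕ, ∀ᶠ t in comap ρ atTop, ‖k t - star (U t) * F t a * U t‖ < 1 / ((n : ℝ) + 1) := by
    intro a
    refine exists_continuous_correction (J := J) hρ (h := fun _ => Q a) continuous_const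
      (g := fun n t => star (U t) * F t a * U t) (fun _ => hGc a)
      (ε := fun n => 1 / ((n : ℝ) + 1)) fun N => ?_
    filter_upwards [hPQ a (1 / ((N : ℝ) + 1)) (by positivity)] with t ⟨b, hb, hlt⟩
    refine ⟨star (U t) * (F t a - P a) * U t - b,
      J.sub_mem (hJ.sandwich_mem _ (hFP t a) _) hb, fun n hn => ?_⟩
    have e : Q a + (star (U t) * (F t a - P a) * U t - b) - star (U t) * F t a * U t
        = -(star (U t) * P a * U t - Q a + b) := by noncomm_ring
    rw [e, norm_neg]
    exact hlt.trans_le (Nat.one_div_le_one_div hn)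
  choose k hk hkQ hkG using key
  refine ⟨fun t a => k a t, hk, hG.extend_of_approx admissibleSet_univ dense_univ dense_univ
    fun a a' _ r har => ?_, fun t a => hkQ a t⟩
  obtain ⟨n, hn⟩ := exists_nat_one_div_lt ((norm_nonneg _).trans_lt har)
  filter_upwards [hkG a n, hG.eventually_norm_sub_lt admissibleSet_univ (Set.mem_univ a)
    (Set.mem_univ a') har] with t h1 h2
  have h3 := norm_sub_le_norm_sub_add_norm_sub (k a t) (star (U t) * F t a * U t)
    (star (U t) * F t a' * U t)
  linarith

theorem LiftsAsymp.of_unitaryEquiv [PartialOrder M]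
    (hJ : ApproxIdeal J) (h : UnitaryEquivMod J P Q) (hP : LiftsAsymp ρ J P) :
    LiftsAsymp ρ J Q := by
  obtain ⟨U, h1, h2, h3⟩ := h
  obtain ⟨F, hFc, hF, hFP⟩ := hP
  refine ⟨_, fun a => ?_, hF.conj (U := fun _ => U) fun _ => ⟨h1, h2⟩, fun t a => ?_⟩
  · have := hFc a
    fun_prop
  · convert J.add_mem (hJ.sandwich_mem (star U) (hFP t a) U) (h3 a) using 1
    noncomm_ring

theorem ContApproxEquivMod.sum_refl {A : Type*} {P Q : A → M} [PartialOrder M] (hJ : ApproxIdeal J)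
    (hS : IsCuntzPair S₁ S₂) (h : ContApproxEquivMod J P Q) (R : A → M) :
    ContApproxEquivMod J (isometrySum S₁ S₂ P R) (isometrySum S₁ S₂ Q R) := by
  obtain ⟨U, hUc, hU, hPQ⟩ := h
  refine ⟨fun t => S₁ * U t * star S₁ + S₂ * star S₂, by fun_prop, fun t => ⟨?_, ?_⟩,
    fun a ε hε => ?_⟩
  · simp only [star_add, star_mul, star_star, mul_add, add_mul, mul_assoc,
      mul_star_mul_cancel hS.star_mul_self_left, mul_star_mul_cancel hS.star_mul_self_right,
      hS.star_mul_left_right_mul, hS.star_mul_right_left_mul, mul_zero, add_zero, zero_add,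
      mul_star_mul_cancel (hU t).1, hS.add_eq_one]
  · have h2' : ∀ x, U t * (star (U t) * x) = x := fun x => by rw [← mul_assoc, (hU t).2, one_mul]
    simp only [star_add, star_mul, star_star, mul_add, add_mul, mul_assoc,
      mul_star_mul_cancel hS.star_mul_self_left, mul_star_mul_cancel hS.star_mul_self_right,
      hS.star_mul_left_right_mul, hS.star_mul_right_left_mul, mul_zero, add_zero, zero_add,
      h2', hS.add_eq_one]
  · filter_upwards [hPQ a ε hε] with t ⟨b, hb, hlt⟩
    refine ⟨S₁ * b * star S₁, hJ.sandwich_mem _ hb _, ?_⟩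
    have e : star (S₁ * U t * star S₁ + S₂ * star S₂) * isometrySum S₁ S₂ P R a
          * (S₁ * U t * star S₁ + S₂ * star S₂) - isometrySum S₁ S₂ Q R a + S₁ * b * star S₁
        = S₁ * (star (U t) * P a * U t - Q a + b) * star S₁ := by
      simp only [isometrySum, star_add, star_mul, star_star, mul_add, add_mul, mul_assoc, mul_sub,
        sub_mul,
        mul_star_mul_cancel hS.star_mul_self_left, mul_star_mul_cancel hS.star_mul_self_right,
        hS.star_mul_left_right_mul, hS.star_mul_right_left_mul, mul_zero, add_zero, zero_add]
      abel
    rw [e]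
    refine lt_of_le_of_lt ?_ hlt
    have hS1 := norm_le_one_of_star_mul_self hS.star_mul_self_left
    calc ‖S₁ * (star (U t) * P a * U t - Q a + b) * star S₁‖
        ≤ ‖S₁‖ * ‖star (U t) * P a * U t - Q a + b‖ * ‖star S₁‖ :=
          (norm_mul_le _ _).trans (by gcongr; exact norm_mul_le _ _)
      _ ≤ 1 * ‖star (U t) * P a * U t - Q a + b‖ * 1 := by rw [norm_star]; gcongr
      _ = _ := by ring

theorem HomotopyMod.sum_refl [PartialOrder M] (hJ : ApproxIdeal J)
    (hS : IsCuntzPair S₁ S₂) (h : HomotopyMod J P Q) {R : A → M} (hR : RepMod J R) :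
    HomotopyMod J (isometrySum S₁ S₂ P R) (isometrySum S₁ S₂ Q R) := by
  obtain ⟨Θ, hmul, hadd, hsmul, hstar, h0, h1⟩ := h
  have hΘ : ∀ s, RepMod J fun a => isometrySum S₁ S₂ (fun a => Θ a s) R a := fun s =>
    RepMod.isometrySum hJ hS ⟨fun a b => hmul a b s, fun a b => hadd a b s,
      fun c a => hsmul c a s, fun a => hstar a s⟩ hR
  have hsub : ∀ (P' Q' : A → M) a, P' a - Q' a ∈ J →
      isometrySum S₁ S₂ P' R a - isometrySum S₁ S₂ Q' R a ∈ J := fun P' Q' a h => by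
    convert hJ.sandwich_mem S₁ h (star S₁) using 1
    simp only [isometrySum]
    noncomm_ring
  exact ⟨fun a => ⟨fun s => isometrySum S₁ S₂ (fun a => Θ a s) R a, by
      unfold isometrySum
      fun_prop⟩, fun a b s => (hΘ s).mul a b, fun a b s => (hΘ s).add a b,
    fun c a s => (hΘ s).smul c a, fun a s => (hΘ s).map_star a,
    fun a => hsub (fun a => Θ a 0) P a (h0 a),
    fun a => hsub (fun a => Θ a 1) Q a (h1 a)⟩

end Stability

section StableEquivalence

variable {A M ι : Type*} [NonUnitalCStarAlgebra A] [CStarAlgebra M]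
  {J : Submodule ℂ M} {S₁ S₂ : M} {P Q : A → M}

/-- A unitary equivalence becomes a homotopy after compressing to the range of an isometry with
infinite co-range. -/
theorem UnitaryEquivMod.homotopyMod [PartialOrder M] (hJ : ApproxIdeal J)
    (h : UnitaryEquivMod J P Q) (hP : RepMod J P) {Y Z : M} (hY : star Y * Y = 1)
    (hZ : star Z * Z = 1) (hYZ : star Y * Z = 0) :
    HomotopyMod J (fun a => Y * P a * star Y) (fun a => Y * Q a * star Y) := by
  obtain ⟨U, h1, h2, h3⟩ := h
  let V : unitInterval → M := fun s => Y * ((1 - s : ℝ) • 1 + (s : ℝ) • star U)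
    + √((s : ℝ) * (1 - s)) • (Z * (1 - U))
  have hVc : Continuous V := by fun_prop
  have hZY : star Z * Y = 0 := by simpa using congrArg star hYZ
  have hVV : ∀ s, star (V s) * V s = 1 := by
    intro s
    have hc : √((s : ℝ) * (1 - s)) * √((s : ℝ) * (1 - s)) = s * (1 - s) :=
      Real.mul_self_sqrt (mul_nonneg s.2.1 (by linarith [s.2.2]))
    simp only [V]
    generalize √((s : ℝ) * (1 - s)) = c at hc ⊢
    simp only [star_add, star_mul, star_smul, star_star, star_trivial, mul_add,
      add_mul, mul_assoc, mul_smul_comm, smul_mul_assoc, mul_sub, sub_mul, star_sub, mul_one,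
      mul_star_mul_cancel hY, hY, hZ, mul_star_mul_cancel hZ, h1, h2, hYZ, hZY,
      ← mul_assoc (star Y) Z, ← mul_assoc (star Z) Y, zero_mul, mul_zero, smul_zero,
      sub_zero, add_zero, zero_add]
    linear_combination (norm := module) hc • ((2 : ℝ) • (1 : M) - U - star U)
  have hΘ : ∀ s, RepMod J fun a => V s * P a * star (V s) := by
    intro s
    constructor
    · intro a b
      convert hJ.sandwich_mem (V s) (hP.mul a b) (star (V s)) using 1
      simp only [mul_assoc, mul_star_mul_cancel (hVV s), mul_sub, sub_mul]
    · intro a b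
      convert hJ.sandwich_mem (V s) (hP.add a b) (star (V s)) using 1
      noncomm_ring
    · intro c a
      convert hJ.sandwich_mem (V s) (hP.smul c a) (star (V s)) using 1
      simp only [mul_sub, sub_mul, mul_smul_comm, smul_mul_assoc]
    · intro a
      convert hJ.sandwich_mem (V s) (hP.map_star a) (star (V s)) using 1
      simp only [star_mul, star_star, mul_sub, sub_mul, mul_assoc]
  have hV0 : V 0 = Y := by simp [V]
  have hV1 : V 1 = Y * star U := by simp [V]
  refine ⟨fun a => ⟨fun s => V s * P a * star (V s), by fun_prop⟩, fun a b s => (hΘ s).mul a b,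
    fun a b s => (hΘ s).add a b, fun c a s => (hΘ s).smul c a, fun a s => (hΘ s).map_star a,
    fun a => ?_, fun a => ?_⟩
  · simp [hV0]
  · convert hJ.sandwich_mem Y (h3 a) (star Y) using 1
    simp only [ContinuousMap.coe_mk, hV1, star_mul, star_star]
    noncomm_ring

theorem UnitaryEquivMod.homotopyMod_sum_zero [PartialOrder M] (hJ : ApproxIdeal J)
    (hS : IsCuntzPair S₁ S₂) {R R' : A → M}
    (h : UnitaryEquivMod J (isometrySum S₁ S₂ P R) (isometrySum S₁ S₂ Q R'))
    (hP : RepMod J P) (hR : RepMod J R) :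
    HomotopyMod J (isometrySum S₁ S₂ P (isometrySum S₁ S₂ R fun _ => 0))
      (isometrySum S₁ S₂ Q (isometrySum S₁ S₂ R' fun _ => 0)) := by
  have key : ∀ P R : A → M, isometrySum S₁ S₂ P (isometrySum S₁ S₂ R fun _ => 0)
      = fun a => (S₁ * star S₁ + S₂ * S₁ * star S₂) * isometrySum S₁ S₂ P R a
        * star (S₁ * star S₁ + S₂ * S₁ * star S₂) := by
    intro P R
    funext a
    simp only [isometrySum, star_add, star_mul, star_star, mul_add, add_mul, mul_assoc,
      mul_star_mul_cancel hS.star_mul_self_left, mul_star_mul_cancel hS.star_mul_self_right,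
      hS.star_mul_left_right_mul, hS.star_mul_right_left_mul, mul_zero, zero_mul, add_zero,
      zero_add]
  rw [key P R, key Q R']
  refine h.homotopyMod hJ (hP.isometrySum hJ hS hR) (Z := S₂ * S₂) ?_ ?_ ?_ <;>
  simp only [star_add, star_mul, star_star, mul_add, add_mul, mul_assoc,
      mul_star_mul_cancel hS.star_mul_self_left, mul_star_mul_cancel hS.star_mul_self_right,
      hS.star_mul_left_right_mul, hS.star_mul_right_left_mul, mul_zero, add_zero,
      zero_add, hS.add_eq_one, hS.star_mul_self_right, hS.star_mul_left_right]

/-- Stable equivalence modulo `J`. -/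
def StablyEquivMod (J : Submodule ℂ M) (S₁ S₂ : M) (triv : (A → M) → Prop)
    (eqv : (A → M) → (A → M) → Prop) (P Q : A → M) : Prop :=
  ∃ R₀ R₁ : A → M, RepMod J R₀ ∧ RepMod J R₁ ∧ triv R₀ ∧ triv R₁ ∧
    eqv (isometrySum S₁ S₂ P R₀) (isometrySum S₁ S₂ Q R₁)

/-- If the unitary stable equivalence classes form a group, then any equivalence relation that is
compatible with direct sums and preserves triviality implies unitary stable equivalence. -/
theorem StablyEquivMod.unitaryEquivMod_of_group [PartialOrder M] (hJ : ApproxIdeal J)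
    (hS : IsCuntzPair S₁ S₂) {triv : (A → M) → Prop} {eqv : (A → M) → (A → M) → Prop}
    (htsum : ∀ P Q, triv P → triv Q → triv (isometrySum S₁ S₂ P Q))
    (htzero : triv fun _ => 0)
    (htunit : ∀ P Q, UnitaryEquivMod J P Q → triv P → triv Q)
    (hesum : ∀ P Q R, RepMod J R → eqv P Q → eqv (isometrySum S₁ S₂ P R) (isometrySum S₁ S₂ Q R))
    (hetriv : ∀ P Q, RepMod J Q → eqv P Q → triv P → triv Q)
    {e : A → M}
    (hid : StablyEquivMod J S₁ S₂ triv (UnitaryEquivMod J) (isometrySum S₁ S₂ (fun _ => 0) e)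
      fun _ => 0)
    (hinv : ∀ T : A → M, RepMod J T → ∃ T', RepMod J T' ∧
      StablyEquivMod J S₁ S₂ triv (UnitaryEquivMod J) (isometrySum S₁ S₂ T T') e)
    (hP : RepMod J P) (hQ : RepMod J Q) (h : StablyEquivMod J S₁ S₂ triv eqv P Q) :
    StablyEquivMod J S₁ S₂ triv (UnitaryEquivMod J) P Q := by
  obtain ⟨G, _, c, hc, hcadd⟩ := exists_addCommSemigroup_classes A hJ hS
  obtain ⟨T, hT, k₀, k₁, hk₀, -, -, htk₁, hk⟩ := hinv P hP
  obtain ⟨m₀, m₁, hm₀, -, -, htm₁, hm⟩ := hid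
  obtain ⟨l₀, l₁, hl₀, hl₁, htl₀, htl₁, hl⟩ := h
  simp only [← hc, hcadd] at hk hm
  have hzero := RepMod.zero (A := A) J
  let R := isometrySum S₁ S₂ T (isometrySum S₁ S₂ k₀ (isometrySum S₁ S₂ (fun _ => 0) m₀))
  have hR : RepMod J R :=
    hT.isometrySum hJ hS (hk₀.isometrySum hJ hS (hzero.isometrySum hJ hS hm₀))
  have htPR : triv (isometrySum S₁ S₂ P R) := by
    refine htunit _ _ ((hc _ _).mp ?_) (htsum _ _ htk₁ (htsum _ _ htzero htm₁))
    simp only [R, hcadd]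
    rw [← hm]
    calc c k₁ + (c (fun _ => 0) + c e + c m₀) = c e + c k₁ + (c (fun _ => 0) + c m₀) := by ac_rfl
      _ = _ := by rw [← hk]; ac_rfl
  have htQR : triv (isometrySum S₁ S₂ (isometrySum S₁ S₂ Q l₁) R) := by
    refine hetriv _ _ ((hQ.isometrySum hJ hS hl₁).isometrySum hJ hS hR) (hesum _ _ R hR hl)
      (htunit _ _ ((hc _ _).mp ?_) (htsum _ _ htPR htl₀))
    simp only [hcadd]
    ac_rfl
  refine ⟨_, _, (hQ.isometrySum hJ hS hl₁).isometrySum hJ hS hR,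
    (hP.isometrySum hJ hS hR).isometrySum hJ hS hl₁, htQR, htsum _ _ htPR htl₁,
    (hc _ _).mp ?_⟩
  simp only [hcadd]
  ac_rfl

variable [TopologicalSpace ι] {ρ : ι → ℝ}

/-- If the unitary stable equivalence classes form a group, then unitary, continuous approximate
unitary and homotopy stable equivalence coincide. -/
theorem stablyEquivMod_iff_of_group [PartialOrder M] [StarOrderedRing M] [NormalSpace ι]
    [ParacompactSpace ι] [TopologicalSpace.SeparableSpace A] (hJ : ApproxIdeal J)
    (hS : IsCuntzPair S₁ S₂) {v : ι → NNReal} (hv : Continuous v)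
    (hcpt : ∀ R : ℝ, IsCompact {t | (v t : ℝ) ≤ R}) {e : A → M}
    (hid : StablyEquivMod J S₁ S₂ (LiftsAsymp (fun t => (v t : ℝ)) J) (UnitaryEquivMod J)
      (isometrySum S₁ S₂ (fun _ => 0) e) fun _ => 0)
    (hinv : ∀ T : A → M, RepMod J T → ∃ T', RepMod J T' ∧
      StablyEquivMod J S₁ S₂ (LiftsAsymp (fun t => (v t : ℝ)) J) (UnitaryEquivMod J)
        (isometrySum S₁ S₂ T T') e)
    (hP : RepMod J P) (hQ : RepMod J Q) :
    (StablyEquivMod J S₁ S₂ (LiftsAsymp (fun t => (v t : ℝ)) J) (ContApproxEquivMod J) P Q ↔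
      StablyEquivMod J S₁ S₂ (LiftsAsymp (fun t => (v t : ℝ)) J) (UnitaryEquivMod J) P Q) ∧
    (StablyEquivMod J S₁ S₂ (LiftsAsymp (fun t => (v t : ℝ)) J) (HomotopyMod J) P Q ↔
      StablyEquivMod J S₁ S₂ (LiftsAsymp (fun t => (v t : ℝ)) J) (ContApproxEquivMod J) P Q) := by
  have hρ : Continuous fun t => (v t : ℝ) := by fun_prop
  have htend : Tendsto v (comap (fun t => (v t : ℝ)) atTop) atTop := by
    rw [← NNReal.comap_coe_atTop, tendsto_comap_iff]
    exact tendsto_comap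
  have G := fun eqv : (A → M) → (A → M) → Prop => StablyEquivMod.unitaryEquivMod_of_group hJ hS
    (triv := LiftsAsymp (fun t => (v t : ℝ)) J) (eqv := eqv) (P := P) (Q := Q) (e := e)
    (fun _ _ h h' => LiftsAsymp.isometrySum hJ hS h h') (LiftsAsymp.zero _ _)
    (fun _ _ h hL => hL.of_unitaryEquiv hJ h)
  have hb : StablyEquivMod J S₁ S₂ (LiftsAsymp (fun t => (v t : ℝ)) J) (ContApproxEquivMod J) P Q
      ↔ StablyEquivMod J S₁ S₂ (LiftsAsymp (fun t => (v t : ℝ)) J) (UnitaryEquivMod J) P Q := by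
    refine ⟨G _ (fun _ _ R _ h => h.sum_refl hJ hS R) (fun _ _ _ ⟨U, hUc, hU, hPQ⟩ hL =>
      hL.of_approxConj hρ hJ (U := fun t => U (v t)) (by fun_prop) (fun t => hU (v t))
        fun a ε hε => htend.eventually (hPQ a ε hε)) hid hinv hP hQ, ?_⟩
    rintro ⟨l₀, l₁, h₀, h₁, ht₀, ht₁, h⟩
    exact ⟨l₀, l₁, h₀, h₁, ht₀, ht₁, h.contApprox⟩
  refine ⟨hb, fun h => hb.mpr ?_, fun h => ?_⟩
  · refine G _ (fun _ _ R hR h => h.sum_refl hJ hS hR) (fun _ _ hQ' h hL => ?_) hid hinv hP hQ h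
    obtain ⟨Θ, hmul, hadd, hsmul, hstar, h0, h1⟩ := h
    exact LiftsAsymp.of_homotopy hρ (fun t => (v t).2) hcpt hJ hQ' hmul hadd hsmul hstar h0 h1 hL
  · obtain ⟨l₀, l₁, h₀, h₁, ht₀, ht₁, h⟩ := hb.mp h
    exact ⟨_, _, h₀.isometrySum hJ hS (RepMod.zero J), h₁.isometrySum hJ hS (RepMod.zero J),
      ht₀.isometrySum hJ hS (LiftsAsymp.zero _ J), ht₁.isometrySum hJ hS (LiftsAsymp.zero _ J),
      h.homotopyMod_sum_zero hJ hS hP h₀⟩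

end StableEquivalence

section Multiplier

variable {B : Type*} [NonUnitalCStarAlgebra B]

/-- The canonical copy of `B` inside its multiplier algebra. -/
def multiplierIdeal (B : Type*) [NonUnitalCStarAlgebra B] : Submodule ℂ 𝓜(ℂ, B) :=
  LinearMap.range (DoubleCentralizer.coeHom (𝕜 := ℂ) (A := B) : B →ₗ[ℂ] 𝓜(ℂ, B))

theorem mem_multiplierIdeal {x : 𝓜(ℂ, B)} :
    x ∈ multiplierIdeal B ↔ ∃ b : B, DoubleCentralizer.coeHom (𝕜 := ℂ) b = x :=
  Iff.rfl

theorem coeHom_mem_multiplierIdeal (b : B) :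
    DoubleCentralizer.coeHom (𝕜 := ℂ) b ∈ multiplierIdeal B :=
  ⟨b, rfl⟩

theorem norm_multiplier_coeHom (b : B) : ‖DoubleCentralizer.coeHom (𝕜 := ℂ) b‖ = ‖b‖ := by
  rw [← DoubleCentralizer.norm_fst]
  exact ContinuousLinearMap.opNorm_mul_apply ℂ B b

theorem multiplier_mul_coeHom (m : 𝓜(ℂ, B)) (b : B) :
    m * DoubleCentralizer.coeHom (𝕜 := ℂ) b = DoubleCentralizer.coeHom (𝕜 := ℂ) (m.fst b) := by
  have h : ∀ x y : B, m.fst (x * y) = m.fst x * y := by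
    intro x y
    refine sub_eq_zero.mp ?_
    have key : ∀ z : B, z * (m.fst (x * y) - m.fst x * y) = 0 := fun z => by
      rw [mul_sub, ← mul_assoc z, ← m.central, ← m.central, mul_assoc, sub_self]
    exact (CStarRing.star_mul_self_eq_zero_iff _).mp (key _)
  refine DoubleCentralizer.ext _ _ _ _ (Prod.ext ?_ ?_)
  · exact ContinuousLinearMap.ext fun x => h b x
  · exact ContinuousLinearMap.ext fun x => m.central x b

theorem approxIdeal_multiplierIdeal [PartialOrder 𝓜(ℂ, B)] [StarOrderedRing 𝓜(ℂ, B)] :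
    ApproxIdeal (multiplierIdeal B) where
  mul_left m x hx := by
    obtain ⟨b, rfl⟩ := mem_multiplierIdeal.mp hx
    exact ⟨m.fst b, (multiplier_mul_coeHom m b).symm⟩
  mul_right m x hx := by
    obtain ⟨b, rfl⟩ := mem_multiplierIdeal.mp hx
    refine ⟨star ((star m).fst (star b)), ?_⟩
    have := congrArg star (multiplier_mul_coeHom (star m) (star b))
    rw [star_mul, map_star, star_star, star_star, ← map_star] at this
    exact this.symm
  star_mem {x} hx := by
    obtain ⟨b, rfl⟩ := mem_multiplierIdeal.mp hx
    exact ⟨star b, map_star (DoubleCentralizer.coeHom (𝕜 := ℂ) (A := B)) b⟩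
  exists_approx X V hX hV η hη := by
    let _ := CStarAlgebra.spectralOrder B
    have _ := CStarAlgebra.spectralOrderedRing B
    let φ : B →⋆ₙₐ[ℂ] 𝓜(ℂ, B) := DoubleCentralizer.coeHom
    have hmono : ∀ {x y : B}, x ≤ y → φ x ≤ φ y := fun h => OrderHomClass.mono φ h
    have hVB : ∀ v ∈ V, ∃ u : B, 0 ≤ u ∧ ‖u‖ < 1 ∧ φ u = v := by
      intro v hv
      obtain ⟨hvJ, hv0, hv1⟩ := hV v hv
      obtain ⟨b, rfl⟩ := mem_multiplierIdeal.mp hvJ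
      have h0 : φ (CFC.sqrt (star b * b)) = φ b := by
        have hr : CFC.sqrt (star b * b) * CFC.sqrt (star b * b) = star b * b :=
          CFC.sqrt_mul_sqrt_self _ (star_mul_self_nonneg b)
        have h1 : φ (CFC.sqrt (star b * b)) * φ (CFC.sqrt (star b * b)) = φ b * φ b := by
          rw [← map_mul, hr, map_mul, map_star, (IsSelfAdjoint.of_nonneg hv0).star_eq]
        have h2 : 0 ≤ φ (CFC.sqrt (star b * b)) := by
          simpa using hmono (CFC.sqrt_nonneg (star b * b))
        rw [← CFC.sqrt_unique h1 h2, CFC.sqrt_unique rfl hv0]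
      refine ⟨CFC.sqrt (star b * b), CFC.sqrt_nonneg _, ?_, h0⟩
      rw [← norm_multiplier_coeHom]
      exact h0 ▸ hv1
    have hev : ∀ᶠ w in CStarAlgebra.approximateUnit B, (∀ v ∈ V, ∀ u : B, 0 ≤ u → ‖u‖ < 1 →
        φ u = v → v ≤ φ w) ∧ ∀ x ∈ X, ‖(1 - φ w) * x‖ ≤ η := by
      refine Eventually.and ((Filter.eventually_all_finset V).mpr fun v hv => ?_)
        ((Filter.eventually_all_finset X).mpr fun x hx => ?_)
      · obtain ⟨u, hu0, hu1, rfl⟩ := hVB v hv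
        filter_upwards [(CStarAlgebra.hasBasis_approximateUnit B).mem_of_mem ⟨hu0, hu1⟩] with w hw
        exact fun _ _ _ _ => hmono hw.1
      · obtain ⟨b, rfl⟩ := mem_multiplierIdeal.mp (hX x hx)
        have := (CStarAlgebra.increasingApproximateUnit B).tendsto_mul_right b
        filter_upwards [(Metric.tendsto_nhds.mp this) η hη] with w hw
        rw [dist_eq_norm, norm_sub_rev, ← norm_multiplier_coeHom, map_sub, map_mul] at hw
        rw [sub_mul, one_mul]
        exact hw.le
    obtain ⟨w, ⟨hw0, hw1⟩, hw⟩ :=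
      (CStarAlgebra.hasBasis_approximateUnit B).eventually_iff.mp hev
    obtain ⟨h1, h2⟩ := hw ⟨le_refl w, by simpa using hw1.le⟩
    refine ⟨φ w, coeHom_mem_multiplierIdeal w, by simpa using hmono hw0,
      (norm_multiplier_coeHom w).trans_lt hw1, fun v hv => ?_, h2⟩
    obtain ⟨u, hu0, hu1, huv⟩ := hVB v hv
    exact h1 v hv u hu0 hu1 huv

end Multiplier

section Bridge

theorem asympHomOn_univ_iff {M ι : Type*} [CStarAlgebra M] {l : Filter ι} {F : ι → A → M} :
    AsympHomOn l Set.univ Set.univ F ↔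
      (∀ a b : A, Tendsto (fun t => ‖F t (a * b) - F t a * F t b‖) l (𝓝 0)) ∧
      (∀ (μ₁ μ₂ : ℂ) (a b : A),
        Tendsto (fun t => ‖F t (μ₁ • a + μ₂ • b) - (μ₁ • F t a + μ₂ • F t b)‖) l (𝓝 0)) ∧
      (∀ a : A, Tendsto (fun t => ‖F t (star a) - star (F t a)‖) l (𝓝 0)) := by
  simp only [← tendsto_zero_iff_norm_tendsto_zero]
  constructor
  · intro h
    refine ⟨fun a b => h.mul a trivial b trivial, fun μ₁ μ₂ a b => ?_,
      fun a => h.map_star a trivial⟩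
    have := ((h.add (μ₁ • a) trivial (μ₂ • b) trivial).add
      (h.smul μ₁ trivial a trivial)).add (h.smul μ₂ trivial b trivial)
    simp only [add_zero] at this
    refine this.congr fun t => ?_
    abel
  · rintro ⟨hmul, hlin, hstar⟩
    refine ⟨fun a _ b _ => hmul a b, fun a _ b _ => ?_, fun c _ a _ => ?_, fun a _ => hstar a⟩
    · simpa using hlin 1 1 a b
    · simpa using hlin c 0 a a

theorem isExtRep_iff {T : A → 𝓜(ℂ, B)} : IsExtRep T ↔ RepMod (multiplierIdeal B) T :=
  ⟨fun h => ⟨h.1, h.2.1, h.2.2.1, h.2.2.2⟩, fun h => ⟨h.mul, h.add, h.smul, h.map_star⟩⟩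

theorem asympSplit_eq : (AsympSplit : (A → 𝓜(ℂ, B)) → Prop)
    = LiftsAsymp (fun t : NNReal => ((id t : NNReal) : ℝ)) (multiplierIdeal B) := by
  funext T
  simp only [AsympSplit, LiftsAsymp, IsAsymptoticHom, id, NNReal.comap_coe_atTop,
    asympHomOn_univ_iff, and_assoc]
  rfl

theorem discAsympSplit_eq : (DiscAsympSplit : (A → 𝓜(ℂ, B)) → Prop)
    = LiftsAsymp (fun n : ℕ => ((n : NNReal) : ℝ)) (multiplierIdeal B) := by
  let _ := CStarAlgebra.spectralOrder 𝓜(ℂ, B)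
  have _ := CStarAlgebra.spectralOrderedRing 𝓜(ℂ, B)
  funext T
  refine propext ⟨?_, ?_⟩
  · rintro ⟨F, ⟨hmul, hlin, hstar, -⟩, hFT⟩
    refine ⟨F, fun _ => continuous_of_discreteTopology, ?_, hFT⟩
    simp only [NNReal.coe_natCast, Nat.comap_cast_atTop]
    exact asympHomOn_univ_iff.mpr ⟨hmul, hlin, hstar⟩
  · rintro ⟨F, -, hF, hFT⟩
    simp only [NNReal.coe_natCast, Nat.comap_cast_atTop] at hF
    obtain ⟨hmul, hlin, hstar⟩ := asympHomOn_univ_iff.mp hF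
    refine ⟨F, ⟨hmul, hlin, hstar, fun a => ?_⟩, hFT⟩
    have hb : IsBoundedUnder (· ≤ ·) atTop fun n => ‖F n a‖ :=
      ⟨_, eventually_map.mpr ((hF.eventually_norm_lt admissibleSet_univ (Set.mem_univ a)
        (lt_add_one ‖a‖)).mono fun n hn => hn.le)⟩
    obtain ⟨C, hC⟩ := hb.bddAbove_range
    exact ⟨C, fun n => hC ⟨n, rfl⟩⟩

theorem coronaNorm_lt_iff {x : 𝓜(ℂ, B)} {ε : ℝ} :
    coronaNorm x < ε ↔ ∃ b ∈ multiplierIdeal B, ‖x + b‖ < ε := by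
  have hb : BddBelow {r : ℝ | ∃ b : B, r = ‖x + (b : 𝓜(ℂ, B))‖} :=
    ⟨0, by rintro _ ⟨b, rfl⟩; exact norm_nonneg _⟩
  have hne : {r : ℝ | ∃ b : B, r = ‖x + (b : 𝓜(ℂ, B))‖}.Nonempty := ⟨_, 0, rfl⟩
  rw [coronaNorm, csInf_lt_iff hb hne]
  constructor
  · rintro ⟨_, ⟨b, rfl⟩, h⟩
    exact ⟨_, coeHom_mem_multiplierIdeal b, h⟩
  · rintro ⟨_, ⟨b, rfl⟩, h⟩
    exact ⟨_, ⟨b, rfl⟩, h⟩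

theorem coronaNorm_nonneg (x : 𝓜(ℂ, B)) : 0 ≤ coronaNorm x :=
  Real.sInf_nonneg (by rintro _ ⟨b, rfl⟩; exact norm_nonneg _)

theorem contApproxUnitaryEquiv_eq {A : Type*} :
    (ContApproxUnitaryEquiv : (A → 𝓜(ℂ, B)) → (A → 𝓜(ℂ, B)) → Prop)
      = ContApproxEquivMod (multiplierIdeal B) := by
  funext P Q
  simp only [ContApproxUnitaryEquiv, ContApproxEquivMod, Metric.tendsto_nhds, dist_zero_right,
    Real.norm_eq_abs, abs_of_nonneg (coronaNorm_nonneg _), coronaNorm_lt_iff]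

theorem stablyEquiv_eq {triv : (A → 𝓜(ℂ, B)) → Prop}
    {eqv : (A → 𝓜(ℂ, B)) → (A → 𝓜(ℂ, B)) → Prop} {S₁ S₂ : 𝓜(ℂ, B)} :
    StablyEquiv S₁ S₂ triv eqv = StablyEquivMod (multiplierIdeal B) S₁ S₂ triv eqv := by
  funext P Q
  simp only [StablyEquiv, StablyEquivMod, isExtRep_iff]
  rfl

theorem stablyEquiv_iff_of_extIsGroup {ι : Type*} [TopologicalSpace ι] [NormalSpace ι]
    [ParacompactSpace ι] [TopologicalSpace.SeparableSpace A] {S₁ S₂ : 𝓜(ℂ, B)}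
    (hS : IsCuntzPair S₁ S₂) {v : ι → NNReal} (hv : Continuous v)
    (hcpt : ∀ R : ℝ, IsCompact {t | (v t : ℝ) ≤ R}) {triv : (A → 𝓜(ℂ, B)) → Prop}
    (htriv : triv = LiftsAsymp (fun t => (v t : ℝ)) (multiplierIdeal B))
    (hG : ExtIsGroup S₁ S₂ triv UnitaryEquiv) (T₀ T₁ : A → 𝓜(ℂ, B)) (h₀ : IsExtRep T₀)
    (h₁ : IsExtRep T₁) :
    (StablyEquiv S₁ S₂ triv ContApproxUnitaryEquiv T₀ T₁ ↔
      StablyEquiv S₁ S₂ triv UnitaryEquiv T₀ T₁) ∧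
    (StablyEquiv S₁ S₂ triv HomotopyEquivExt T₀ T₁ ↔
      StablyEquiv S₁ S₂ triv ContApproxUnitaryEquiv T₀ T₁) := by
  let _ := CStarAlgebra.spectralOrder 𝓜(ℂ, B)
  have _ := CStarAlgebra.spectralOrderedRing 𝓜(ℂ, B)
  subst htriv
  obtain ⟨e, -, hid, hinv⟩ := hG
  simp only [stablyEquiv_eq, contApproxUnitaryEquiv_eq, isExtRep_iff] at *
  exact stablyEquivMod_iff_of_group approxIdeal_multiplierIdeal hS hv hcpt
    (hid _ (RepMod.zero _)) hinv h₀ h₁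

theorem isCompact_setOf_nnreal_le (R : ℝ) : IsCompact {t : NNReal | (t : ℝ) ≤ R} := by
  have h : {t : NNReal | (t : ℝ) ≤ R} = NNReal.toReal ⁻¹' Set.Icc 0 R :=
    Set.ext fun t => ⟨fun ht => ⟨t.2, ht⟩, fun ht => ht.2⟩
  rw [h]
  exact NNReal.isClosedEmbedding_coe.isCompact_preimage isCompact_Icc

theorem isCompact_setOf_natCast_le (R : ℝ) : IsCompact {n : ℕ | ((n : NNReal) : ℝ) ≤ R} := by
  obtain ⟨N, hN⟩ := exists_nat_gt R
  refine ((Set.finite_le_nat N).subset fun n hn => ?_).isCompact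
  have h : (n : ℝ) ≤ R := by simpa using hn
  exact_mod_cast (h.trans hN.le)

end Bridge

/-- **Coincidence of extension groups.**  Let `A` be a separable C*-algebra and `B` a stable
C*-algebra (stability providing a pair of isometries `S₁, S₂ ∈ M(B)` with
`S₁S₁* + S₂S₂* = 1`, used to form sums of extensions).  If the extension semigroups
`Ext_{2,a}(A,B)`, `Ext_{2,b^cont}(A,B)`, `Ext_{2,c}(A,B)` (trivial = asymptotically split;
equivalence = unitary / continuous approximate unitary / homotopy) are all groups, then the
natural surjections between them are isomorphisms, i.e. the corresponding stable equivalence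
relations coincide.  Likewise for `Ext_{3,a}`, `Ext_{3,b^cont}`, `Ext_{3,c}`
(trivial = discretely asymptotically split). -/
theorem ext_groups_coincide
    [TopologicalSpace.SeparableSpace A]
    (S₁ S₂ : 𝓜(ℂ, B))
    (hS₁ : star S₁ * S₁ = 1) (hS₂ : star S₂ * S₂ = 1)
    (hSsum : S₁ * star S₁ + S₂ * star S₂ = 1) :
    -- the `Ext₂` case
    ((ExtIsGroup S₁ S₂ (AsympSplit (A := A)) UnitaryEquiv →
      ExtIsGroup S₁ S₂ (AsympSplit (A := A)) ContApproxUnitaryEquiv →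
      ExtIsGroup S₁ S₂ (AsympSplit (A := A)) HomotopyEquivExt →
      ∀ T₀ T₁ : A → 𝓜(ℂ, B), IsExtRep T₀ → IsExtRep T₁ →
        (StablyEquiv S₁ S₂ AsympSplit ContApproxUnitaryEquiv T₀ T₁ ↔
          StablyEquiv S₁ S₂ AsympSplit UnitaryEquiv T₀ T₁) ∧
        (StablyEquiv S₁ S₂ AsympSplit HomotopyEquivExt T₀ T₁ ↔
          StablyEquiv S₁ S₂ AsympSplit ContApproxUnitaryEquiv T₀ T₁)) ∧
    -- the `Ext₃` case
    (ExtIsGroup S₁ S₂ (DiscAsympSplit (A := A)) UnitaryEquiv →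
      ExtIsGroup S₁ S₂ (DiscAsympSplit (A := A)) ContApproxUnitaryEquiv →
      ExtIsGroup S₁ S₂ (DiscAsympSplit (A := A)) HomotopyEquivExt →
      ∀ T₀ T₁ : A → 𝓜(ℂ, B), IsExtRep T₀ → IsExtRep T₁ →
        (StablyEquiv S₁ S₂ DiscAsympSplit ContApproxUnitaryEquiv T₀ T₁ ↔
          StablyEquiv S₁ S₂ DiscAsympSplit UnitaryEquiv T₀ T₁) ∧
        (StablyEquiv S₁ S₂ DiscAsympSplit HomotopyEquivExt T₀ T₁ ↔
          StablyEquiv S₁ S₂ DiscAsympSplit ContApproxUnitaryEquiv T₀ T₁))) := by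
  have hS : IsCuntzPair S₁ S₂ := ⟨hS₁, hS₂, hSsum⟩
  exact ⟨fun hG _ _ => stablyEquiv_iff_of_extIsGroup hS continuous_id isCompact_setOf_nnreal_le
      asympSplit_eq hG,
    fun hG _ _ => stablyEquiv_iff_of_extIsGroup hS continuous_of_discreteTopology
      isCompact_setOf_natCast_le discAsympSplit_eq hG⟩

end
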